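/- Every (P2+P3, gem)-free graph G with ω(G) ≥ 4 satisfies χ(G) ≤ ⌈(5ω(G) − 1)/4⌉. -/

import Mathlib

open SimpleGraph

/-- The graph `P2 + P3` (disjoint union of a path on 2 and a path on 3 vertices). -/
def graphP2P3 : SimpleGraph (Fin 5) :=
  SimpleGraph.fromRel (fun x y => (x, y) ∈ ([(0,1),(2,3),(3,4)] : List (Fin 5 × Fin 5)))

/-- The gem: a path `P4` (0-1-2-3) plus a vertex 4 adjacent to all of it. -/
def graphGem : SimpleGraph (Fin 5) :=
  SimpleGraph.fromRel (fun x y =>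
    (x, y) ∈ ([(0,1),(1,2),(2,3),(4,0),(4,1),(4,2),(4,3)] : List (Fin 5 × Fin 5)))

/-- The path on three vertices. -/
def graphP3 : SimpleGraph (Fin 3) :=
  SimpleGraph.fromRel (fun x y => (x, y) ∈ ([(0,1),(1,2)] : List (Fin 3 × Fin 3)))

/-- The cycle on five vertices. -/
def graphC5 : SimpleGraph (Fin 5) :=
  SimpleGraph.fromRel (fun x y => y = x + 1)

/-- `F1`: a 5-cycle `v1 v2 v3 v4 v5` (vertices 0..4) plus a vertex 5 adjacent
exactly to `v5, v1, v2` (i.e. 4, 0, 1). -/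
def graphF1 : SimpleGraph (Fin 6) :=
  SimpleGraph.fromRel (fun x y =>
    (x, y) ∈ ([(0,1),(1,2),(2,3),(3,4),(4,0),(5,4),(5,0),(5,1)] : List (Fin 6 × Fin 6)))

/-- `F1'`: a 5-cycle (0..4) plus adjacent vertices 5, 6, where 5 is adjacent to 4,0,1
and 6 is adjacent to 0,1,2. -/
def graphF1' : SimpleGraph (Fin 7) :=
  SimpleGraph.fromRel (fun x y =>
    (x, y) ∈ ([(0,1),(1,2),(2,3),(3,4),(4,0),(5,4),(5,0),(5,1),(6,0),(6,1),(6,2),(5,6)] :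
      List (Fin 7 × Fin 7)))

/-- `F1''`: a 5-cycle (0..4) plus nonadjacent vertices 5, 6, where 5 is adjacent to 4,0,1
and 6 is adjacent to 1,2,3. -/
def graphF1'' : SimpleGraph (Fin 7) :=
  SimpleGraph.fromRel (fun x y =>
    (x, y) ∈ ([(0,1),(1,2),(2,3),(3,4),(4,0),(5,4),(5,0),(5,1),(6,1),(6,2),(6,3)] :
      List (Fin 7 × Fin 7)))

/-- `F2`: a 5-cycle (0..4) plus adjacent vertices 5, 6, each adjacent to `v1,v3,v4`
(i.e. 0, 2, 3). -/
def graphF2 : SimpleGraph (Fin 7) :=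
  SimpleGraph.fromRel (fun x y =>
    (x, y) ∈ ([(0,1),(1,2),(2,3),(3,4),(4,0),(5,6),(5,0),(5,2),(5,3),(6,0),(6,2),(6,3)] :
      List (Fin 7 × Fin 7)))

/-- `F3`: a 5-cycle (0..4) plus adjacent vertices 5 (adjacent to 0,2,3) and
6 (adjacent to 2,3). -/
def graphF3 : SimpleGraph (Fin 7) :=
  SimpleGraph.fromRel (fun x y =>
    (x, y) ∈ ([(0,1),(1,2),(2,3),(3,4),(4,0),(5,6),(5,0),(5,2),(5,3),(6,2),(6,3)] :
      List (Fin 7 × Fin 7)))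

/-- `G` contains no induced copy of `H`. -/
def IsFreeOf {W V : Type*} (G : SimpleGraph V) (H : SimpleGraph W) : Prop :=
  IsEmpty (H ↪g G)

/-- The disjoint union of a clique blowup `C5⟨K_{t 0},…,K_{t 4}⟩` of the 5-cycle and
`ℓ` isolated vertices. -/
def blowupC5 (t : Fin 5 → ℕ) (ℓ : ℕ) :
    SimpleGraph ((Σ i : Fin 5, Fin (t i)) ⊕ Fin ℓ) :=
  SimpleGraph.fromRel (fun x y => ∃ a b, x = Sum.inl a ∧ y = Sum.inl b ∧
    (a.1 = b.1 ∨ b.1 = a.1 + 1))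

/-- Membership in the class `𝒞`: `G` is isomorphic to the disjoint union of a clique
blowup of `C5` and some number of isolated vertices. -/
def InClassC {V : Type*} (G : SimpleGraph V) : Prop :=
  ∃ (t : Fin 5 → ℕ) (ℓ : ℕ), (∀ i, 0 < t i) ∧ Nonempty (G ≃g blowupC5 t ℓ)

/-- The function φ from the paper. -/
noncomputable def phi (x : ℕ) : ℕ :=
  if x = 1 then 1 else if x = 2 then 4 else if x = 3 then 6
  else ⌈(5 * (x : ℚ) - 1) / 4⌉₊

section Stmt
variable {V : Type*} (G : SimpleGraph V)

/-- `S` is complete to `S'`. -/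
def CompleteTo (S S' : Set V) : Prop := ∀ x ∈ S, ∀ y ∈ S', G.Adj x y

/-- `S` is anticomplete to `S'`. -/
def AnticompleteTo (S S' : Set V) : Prop := ∀ x ∈ S, ∀ y ∈ S', ¬ G.Adj x y

/-- `S` is a stable (independent) set. -/
def IsStableSet (S : Set V) : Prop := S.Pairwise (fun x y => ¬ G.Adj x y)

/-- A graph is perfect if every induced subgraph has chromatic number equal to
its clique number. -/
def IsPerfect : Prop :=
  ∀ S : Set V, (G.induce S).chromaticNumber = ((G.induce S).cliqueNum : ℕ∞)

variable (v : Fin 5 → V)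

/-- `v` induces a `C5` in `G`: two cycle vertices are adjacent iff consecutive. -/
def IsInducedC5 : Prop :=
  Function.Injective v ∧ ∀ i j : Fin 5, G.Adj (v i) (v j) ↔ (j = i + 1 ∨ i = j + 1)

def setA (i : Fin 5) : Set V :=
  {u | u ∉ Set.range v ∧ ∀ j, G.Adj u (v j) ↔ j = i}

def setB (i : Fin 5) : Set V :=
  {u | u ∉ Set.range v ∧ ∀ j, G.Adj u (v j) ↔ (j = i ∨ j = i + 1)}

def setX (i : Fin 5) : Set V :=
  {u | u ∉ Set.range v ∧ ∀ j, G.Adj u (v j) ↔ (j = i - 1 ∨ j = i + 1)}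

def setY (i : Fin 5) : Set V :=
  {u | u ∉ Set.range v ∧ ∀ j, G.Adj u (v j) ↔ (j = i - 1 ∨ j = i ∨ j = i + 1)}

def setZ (i : Fin 5) : Set V :=
  {u | u ∉ Set.range v ∧ ∀ j, G.Adj u (v j) ↔ (j = i - 2 ∨ j = i ∨ j = i + 2)}

def setT : Set V :=
  {u | u ∉ Set.range v ∧ ∀ j, ¬ G.Adj u (v j)}

end Stmt


section CliqueTraces

open scoped Classical

variable {V : Type*} {G : SimpleGraph V} {Q : Finset V}

theorem no_induced_P2P3 (hG : IsFreeOf G graphP2P3) {a b c d e : V} (hab : G.Adj a b)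
    (hcd : G.Adj c d) (hde : G.Adj d e) (hce : ¬ G.Adj c e) (hne : c ≠ e)
    (hac : ¬ G.Adj a c) (had : ¬ G.Adj a d) (hae : ¬ G.Adj a e)
    (hbc : ¬ G.Adj b c) (hbd : ¬ G.Adj b d) (hbe : ¬ G.Adj b e) : False := by
  have h1 : a ≠ c := by rintro rfl; exact hbc hab.symm
  have h2 : a ≠ d := by rintro rfl; exact hbd hab.symm
  have h3 : a ≠ e := by rintro rfl; exact hbe hab.symm
  have h4 : b ≠ c := by rintro rfl; exact hac hab
  have h5 : b ≠ d := by rintro rfl; exact had hab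
  have h6 : b ≠ e := by rintro rfl; exact hae hab
  have h7 := hab.ne
  have h8 := hcd.ne
  have h9 := hde.ne
  have hinj : Function.Injective ![a, b, c, d, e] := by
    intro i j hij
    fin_cases i <;> fin_cases j <;>
      simp [h1, h2, h3, h4, h5, h6, h7, h8, h9, hne, h1.symm, h2.symm, h3.symm, h4.symm,
        h5.symm, h6.symm, h7.symm, h8.symm, h9.symm, hne.symm] at hij ⊢
  refine hG.false ⟨⟨![a, b, c, d, e], hinj⟩, ?_⟩
  intro i j
  change G.Adj (![a, b, c, d, e] i) (![a, b, c, d, e] j) ↔ _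
  fin_cases i <;> fin_cases j <;>
    simp [graphP2P3, SimpleGraph.fromRel_adj, hab, hab.symm, hcd, hcd.symm, hde, hde.symm, hce,
      G.adj_comm e c, hac, G.adj_comm c a, had, G.adj_comm d a, hae, G.adj_comm e a, hbc,
      G.adj_comm c b, hbd, G.adj_comm d b, hbe, G.adj_comm e b]

theorem no_induced_gem (hG : IsFreeOf G graphGem) {a b c d x : V} (hab : G.Adj a b)
    (hbc : G.Adj b c) (hcd : G.Adj c d) (hac : ¬ G.Adj a c) (had : ¬ G.Adj a d)
    (hbd : ¬ G.Adj b d) (hxa : G.Adj x a) (hxb : G.Adj x b) (hxc : G.Adj x c)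
    (hxd : G.Adj x d) : False := by
  have h1 : a ≠ c := by rintro rfl; exact had hcd
  have h2 : a ≠ d := by rintro rfl; exact hac hcd.symm
  have h3 : b ≠ d := by rintro rfl; exact had hab
  have h7 := hab.ne
  have h8 := hbc.ne
  have h9 := hcd.ne
  have h10 := hxa.ne
  have h11 := hxb.ne
  have h12 := hxc.ne
  have h13 := hxd.ne
  have hinj : Function.Injective ![a, b, c, d, x] := by
    intro i j hij
    fin_cases i <;> fin_cases j <;>
      simp [h1, h2, h3, h7, h8, h9, h10, h11, h12, h13, h1.symm, h2.symm, h3.symm, h7.symm,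
        h8.symm, h9.symm, h10.symm, h11.symm, h12.symm, h13.symm] at hij ⊢
  refine hG.false ⟨⟨![a, b, c, d, x], hinj⟩, ?_⟩
  intro i j
  change G.Adj (![a, b, c, d, x] i) (![a, b, c, d, x] j) ↔ _
  fin_cases i <;> fin_cases j <;>
    simp [graphGem, SimpleGraph.fromRel_adj, hab, hab.symm, hbc, hbc.symm, hcd, hcd.symm, hac,
      G.adj_comm c a, had, G.adj_comm d a, hbd, G.adj_comm d b, hxa, hxa.symm, hxb, hxb.symm,
      hxc, hxc.symm, hxd, hxd.symm]

/-- The neighbours of `u` inside `Q`. -/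
noncomputable def traceOn (G : SimpleGraph V) (Q : Finset V) (u : V) : Finset V :=
  Q.filter fun q => G.Adj u q

local notation "τ" => traceOn G Q

theorem mem_traceOn {u q : V} : q ∈ τ u ↔ q ∈ Q ∧ G.Adj u q := by simp [traceOn]

theorem traceOn_subset (u : V) : τ u ⊆ Q := Finset.filter_subset _ _

theorem traceOn_union_subset (u v : V) : τ u ∪ τ v ⊆ Q :=
  Finset.union_subset (traceOn_subset u) (traceOn_subset v)

theorem adj_of_mem_traceOn {u q : V} (hq : q ∈ τ u) : G.Adj u q := (mem_traceOn.1 hq).2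

theorem mem_of_mem_traceOn {u q : V} (hq : q ∈ τ u) : q ∈ Q := (mem_traceOn.1 hq).1

theorem not_adj_of_notMem_traceOn {u q : V} (hq : q ∈ Q) (hu : q ∉ τ u) : ¬ G.Adj u q :=
  fun hadj => hu (mem_traceOn.2 ⟨hq, hadj⟩)

/-- `Q` is a maximum clique, of size at least four, of a `(P2+P3, gem)`-free graph `G`. -/
structure CliqueSetting (G : SimpleGraph V) (Q : Finset V) : Prop where
  p2p3_free : IsFreeOf G graphP2P3
  gem_free : IsFreeOf G graphGem
  isClique : G.IsClique (Q : Set V)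
  card_le : ∀ K : Finset V, G.IsClique (K : Set V) → K.card ≤ Q.card
  four_le : 4 ≤ Q.card

namespace CliqueSetting

variable (h : CliqueSetting G Q)
include h

theorem adj_of_mem {p q : V} (hp : p ∈ Q) (hq : q ∈ Q) (hpq : p ≠ q) : G.Adj p q :=
  h.isClique hp hq hpq

theorem card_add_card_le {S K : Finset V} (hS : S ⊆ Q) (hK : G.IsClique (K : Set V))
    (hSK : ∀ k ∈ K, S ⊆ τ k) : S.card + K.card ≤ Q.card := by
  have hd : Disjoint S K := by
    rw [Finset.disjoint_left]
    intro k hkS hkK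
    exact G.irrefl (adj_of_mem_traceOn (hSK k hkK hkS))
  rw [← Finset.card_union_of_disjoint hd]
  refine h.card_le _ fun x hx y hy hxy => ?_
  simp only [Finset.coe_union, Set.mem_union, Finset.mem_coe] at hx hy
  rcases hx with hx | hx <;> rcases hy with hy | hy
  · exact h.adj_of_mem (hS hx) (hS hy) hxy
  · exact (adj_of_mem_traceOn (hSK y hy hx)).symm
  · exact adj_of_mem_traceOn (hSK x hx hy)
  · exact hK hx hy hxy

theorem card_traceOn_lt (u : V) : (τ u).card + 1 ≤ Q.card := by
  have := h.card_add_card_le (S := τ u) (K := {u}) (traceOn_subset u) (by simp) (by simp)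
  simpa using this

theorem card_add_two_le {u v : V} (huv : G.Adj u v) {S : Finset V} (hu : S ⊆ τ u)
    (hv : S ⊆ τ v) : S.card + 2 ≤ Q.card := by
  have := h.card_add_card_le (S := S) (K := {u, v}) (hu.trans (traceOn_subset u))
    (by simpa [SimpleGraph.isClique_pair] using fun _ => huv) (by simp [hu, hv])
  rwa [Finset.card_pair huv.ne] at this

theorem exists_notMem_traceOn (u : V) : ∃ q ∈ Q, q ∉ τ u := by
  by_contra! hc
  have := Finset.card_le_card (s := Q) (t := τ u) hc
  have := h.card_traceOn_lt u
  omega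

theorem not_gem_of_adj {u v a b q : V} (huv : G.Adj u v) (hqu : q ∈ τ u) (hqv : q ∈ τ v)
    (hau : a ∈ τ u) (hav : a ∉ τ v) (hb : b ∈ Q) (hbu : b ∉ τ u) (hbv : b ∉ τ v) : False := by
  have haQ := mem_of_mem_traceOn hau
  have hqQ := mem_of_mem_traceOn hqu
  refine no_induced_gem h.gem_free (a := v) (b := u) (c := a) (d := b) (x := q) huv.symm
    (adj_of_mem_traceOn hau) (h.adj_of_mem haQ hb ?_) (not_adj_of_notMem_traceOn haQ hav)
    (not_adj_of_notMem_traceOn hb hbv) (not_adj_of_notMem_traceOn hb hbu)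
    (adj_of_mem_traceOn hqv).symm (adj_of_mem_traceOn hqu).symm (h.adj_of_mem hqQ haQ ?_)
    (h.adj_of_mem hqQ hb ?_)
  · rintro rfl; exact hbu hau
  · rintro rfl; exact hav hqv
  · rintro rfl; exact hbu hqu

theorem eq_or_union_eq {u v q : V} (huv : G.Adj u v) (hqu : q ∈ τ u) (hqv : q ∈ τ v) :
    τ u = τ v ∨ τ u ∪ τ v = Q := by
  by_contra! hc
  obtain ⟨hne, hcov⟩ := hc
  obtain ⟨b, hb, hb'⟩ : ∃ b ∈ Q, b ∉ τ u ∪ τ v := by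
    by_contra! hb
    exact hcov (Finset.Subset.antisymm
      (Finset.union_subset (traceOn_subset u) (traceOn_subset v)) hb)
  simp only [Finset.mem_union, not_or] at hb'
  by_cases hs : τ u ⊆ τ v
  · obtain ⟨a, hav, hau⟩ := Finset.exists_of_ssubset (hs.ssubset_of_ne hne)
    exact h.not_gem_of_adj huv.symm hqv hqu hav hau hb hb'.2 hb'.1
  · obtain ⟨a, hau, hav⟩ := Finset.not_subset.1 hs
    exact h.not_gem_of_adj huv hqu hqv hau hav hb hb'.1 hb'.2

theorem subset_or_subset {u v q : V} (huv : ¬ G.Adj u v) (hqu : q ∈ τ u) (hqv : q ∈ τ v) :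
    τ u ⊆ τ v ∨ τ v ⊆ τ u := by
  by_contra! hc
  obtain ⟨s, hsu, hsv⟩ := Finset.not_subset.1 hc.1
  obtain ⟨t, htv, htu⟩ := Finset.not_subset.1 hc.2
  have hsQ := mem_of_mem_traceOn hsu
  have htQ := mem_of_mem_traceOn htv
  have hqQ := mem_of_mem_traceOn hqu
  refine no_induced_gem h.gem_free (a := u) (b := s) (c := t) (d := v) (x := q)
    (adj_of_mem_traceOn hsu) (h.adj_of_mem hsQ htQ ?_) (adj_of_mem_traceOn htv).symm
    (not_adj_of_notMem_traceOn htQ htu) huv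
    (fun hadj => not_adj_of_notMem_traceOn hsQ hsv hadj.symm)
    (adj_of_mem_traceOn hqu).symm (h.adj_of_mem hqQ hsQ ?_) (h.adj_of_mem hqQ htQ ?_)
    (adj_of_mem_traceOn hqv).symm
  · rintro rfl; exact htu hsu
  · rintro rfl; exact hsv hqv
  · rintro rfl; exact htu hqu

theorem adj_trans_of_subset {S : Finset V} (hS : S.card + 2 ≤ Q.card) {u v w : V}
    (hu : τ u ⊆ S) (hv : τ v ⊆ S) (hw : τ w ⊆ S) (huv : G.Adj u v) (hvw : G.Adj v w)
    (huw : u ≠ w) : G.Adj u w := by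
  by_contra hn
  have hc : 2 ≤ (Q \ S).card := by
    have := Finset.le_card_sdiff S Q
    omega
  obtain ⟨a, ha, b, hb, hab⟩ := Finset.one_lt_card.1 hc
  rw [Finset.mem_sdiff] at ha hb
  have key : ∀ {x q : V}, τ x ⊆ S → q ∈ Q → q ∉ S → ¬ G.Adj q x := fun hx hq hqS hadj =>
    hqS (hx (mem_traceOn.2 ⟨hq, hadj.symm⟩))
  exact no_induced_P2P3 h.p2p3_free (h.adj_of_mem ha.1 hb.1 hab) huv hvw hn huw
    (key hu ha.1 ha.2) (key hv ha.1 ha.2) (key hw ha.1 ha.2)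
    (key hu hb.1 hb.2) (key hv hb.1 hb.2) (key hw hb.1 hb.2)

theorem mem_traceOn_of_anti {u v w p q : V} (huv : G.Adj u v) (hwu : ¬ G.Adj w u)
    (hwv : ¬ G.Adj w v) (hw : w ∉ Q) (hp : p ∈ τ w) (hpu : p ∉ τ u) (hpv : p ∉ τ v)
    (hq : q ∈ Q) (hqu : q ∉ τ u) (hqv : q ∉ τ v) : q ∈ τ w := by
  by_contra hqw
  have hpQ := mem_of_mem_traceOn hp
  refine no_induced_P2P3 h.p2p3_free huv (adj_of_mem_traceOn hp) (h.adj_of_mem hpQ hq ?_)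
    (not_adj_of_notMem_traceOn hq hqw) ?_ (fun hh => hwu hh.symm)
    (not_adj_of_notMem_traceOn hpQ hpu) (not_adj_of_notMem_traceOn hq hqu)
    (fun hh => hwv hh.symm) (not_adj_of_notMem_traceOn hpQ hpv) (not_adj_of_notMem_traceOn hq hqv)
  · rintro rfl; exact hqw hp
  · rintro rfl; exact hw hq

theorem subset_or_subset_of_adj_empty {r u v q : V} (hr : τ r = ∅) (hru : G.Adj r u)
    (hrv : G.Adj r v) (hqu : q ∈ τ u) (hqv : q ∈ τ v) : τ u ⊆ τ v ∨ τ v ⊆ τ u := by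
  by_contra hc
  have huv : G.Adj u v := by
    by_contra huv
    exact hc (h.subset_or_subset huv hqu hqv)
  have hrQ : ∀ {x : V}, x ∈ Q → ¬ G.Adj r x := fun hx =>
    not_adj_of_notMem_traceOn hx (by simp [hr])
  push Not at hc
  obtain ⟨s, hsu, hsv⟩ := Finset.not_subset.1 hc.1
  have hsQ := mem_of_mem_traceOn hsu
  have hqQ := mem_of_mem_traceOn hqu
  refine no_induced_gem h.gem_free (a := r) (b := v) (c := q) (d := s) (x := u) hrv
    (adj_of_mem_traceOn hqv) (h.adj_of_mem hqQ hsQ ?_) (hrQ hqQ) (hrQ hsQ)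
    (not_adj_of_notMem_traceOn hsQ hsv) hru.symm huv (adj_of_mem_traceOn hqu)
    (adj_of_mem_traceOn hsu)
  rintro rfl; exact hsv hqv

theorem union_eq_of_big {u v : V} (huv : G.Adj u v) (hv : (τ v).Nonempty)
    (hu : Q.card ≤ (τ u).card + 1) : τ u ∪ τ v = Q := by
  by_cases hd : Disjoint (τ u) (τ v)
  · refine Finset.eq_of_subset_of_card_le
      (Finset.union_subset (traceOn_subset u) (traceOn_subset v)) ?_
    rw [Finset.card_union_of_disjoint hd]
    have := hv.card_pos
    omega
  · obtain ⟨q, hqu, hqv⟩ := Finset.not_disjoint_iff.1 hd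
    rcases h.eq_or_union_eq huv hqu hqv with he | he
    · have := h.card_add_two_le huv (S := τ u) subset_rfl he.le
      omega
    · exact he

theorem notMem_of_small {u : V} (hu : (τ u).card + 2 ≤ Q.card) : u ∉ Q := by
  intro huQ
  have : Q.erase u ⊆ τ u := fun q hq => mem_traceOn.2 ⟨(Finset.mem_erase.1 hq).2,
    h.adj_of_mem huQ (Finset.mem_erase.1 hq).2 (Finset.mem_erase.1 hq).1.symm⟩
  have := Finset.card_le_card this
  rw [Finset.card_erase_of_mem huQ] at this
  omega

end CliqueSetting

theorem exists_injOn_of_hall_two {α β : Type*} [Nonempty β] (K : Finset α) (l : α → Finset β)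
    (h₁ : ∀ u ∈ K, (K.filter fun v => l v = l u).card ≤ (l u).card)
    (h₂ : ∀ u ∈ K, ∀ v ∈ K, l u ≠ l v → K.card ≤ (l u ∪ l v).card) :
    ∃ f : α → β, Set.InjOn f K ∧ ∀ u ∈ K, f u ∈ l u := by
  have hall : ∀ s : Finset K, s.card ≤ (s.biUnion fun x => l x).card := by
    intro s
    rcases s.eq_empty_or_nonempty with rfl | ⟨u, hu⟩
    · simp
    have hmap : (s.map (Function.Embedding.subtype _)) ⊆ K := fun x hx => by
      obtain ⟨y, -, rfl⟩ := Finset.mem_map.1 hx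
      exact y.2
    by_cases hs : ∀ v ∈ s, l v = l u
    · calc s.card = (s.map (Function.Embedding.subtype _)).card := (Finset.card_map _).symm
        _ ≤ (K.filter fun v => l v = l u).card := by
          refine Finset.card_le_card fun x hx => Finset.mem_filter.2 ⟨hmap hx, ?_⟩
          obtain ⟨y, hy, rfl⟩ := Finset.mem_map.1 hx
          exact hs y hy
        _ ≤ (l u).card := h₁ u u.2
        _ ≤ _ := Finset.card_le_card (Finset.subset_biUnion_of_mem (fun x : K => l x) hu)
    · push Not at hs
      obtain ⟨v, hv, hvu⟩ := hs
      calc s.card = (s.map (Function.Embedding.subtype _)).card := (Finset.card_map _).symm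
        _ ≤ K.card := Finset.card_le_card hmap
        _ ≤ (l v ∪ l u).card := h₂ v v.2 u u.2 hvu
        _ ≤ _ := Finset.card_le_card (Finset.union_subset
          (Finset.subset_biUnion_of_mem (fun x : K => l x) hv)
          (Finset.subset_biUnion_of_mem (fun x : K => l x) hu))
  obtain ⟨f, hf, hfl⟩ := (Finset.all_card_le_biUnion_card_iff_exists_injective _).1 hall
  refine ⟨fun x => if hx : x ∈ K then f ⟨x, hx⟩ else Classical.arbitrary β, ?_, ?_⟩
  · intro x hx y hy hxy
    simp only [Finset.mem_coe] at hx hy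
    simp only [hx, hy, dif_pos] at hxy
    simpa using hf hxy
  · intro u hu
    simpa only [hu, dif_pos] using hfl ⟨u, hu⟩

theorem exists_injOn_of_card_le {α β : Type*} [Nonempty β] (K : Finset α) (l : α → Finset β)
    (hl : ∀ u ∈ K, K.card ≤ (l u).card) : ∃ f : α → β, Set.InjOn f K ∧ ∀ u ∈ K, f u ∈ l u :=
  exists_injOn_of_hall_two K l (fun u hu => (Finset.card_filter_le _ _).trans (hl u hu))
    fun u hu _ _ _ => (hl u hu).trans (Finset.card_le_card Finset.subset_union_left)

theorem exists_coloring_of_transitive [Fintype V] {α : Type*} (U : Set V)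
    (htr : ∀ u ∈ U, ∀ v ∈ U, ∀ w ∈ U, G.Adj u v → G.Adj v w → u ≠ w → G.Adj u w)
    (P : V → α → Prop)
    (hP : ∀ K : Finset V, G.IsClique (K : Set V) → (∀ u ∈ K, u ∈ U) → K.Nonempty →
      ∃ f : V → α, Set.InjOn f K ∧ ∀ u ∈ K, P u (f u)) [Nonempty α] :
    ∃ c : V → α, (∀ u ∈ U, P u (c u)) ∧ ∀ u ∈ U, ∀ v ∈ U, G.Adj u v → c u ≠ c v := by
  let comp : V → Finset V := fun u => Finset.univ.filter fun v => v ∈ U ∧ (v = u ∨ G.Adj u v)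
  have hself : ∀ u ∈ U, u ∈ comp u := fun u hu => by simp [comp, hu]
  have hcomp : ∀ u ∈ U, G.IsClique (comp u : Set V) := by
    intro u hu x hx y hy hxy
    simp only [comp, Finset.coe_filter, Finset.mem_univ, true_and, Set.mem_ofPred_eq] at hx hy
    obtain ⟨hxU, rfl | hx⟩ := hx <;> obtain ⟨hyU, rfl | hy⟩ := hy
    · exact (hxy rfl).elim
    · exact hy
    · exact hx.symm
    · exact htr x hxU u hu y hyU hx.symm hy hxy
  have heq : ∀ u ∈ U, ∀ v ∈ U, G.Adj u v → comp u = comp v := by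
    have hsub : ∀ u ∈ U, ∀ v ∈ U, G.Adj u v → comp u ⊆ comp v := by
      intro u hu v hv huv x hx
      simp only [comp, Finset.mem_filter, Finset.mem_univ, true_and] at hx ⊢
      refine ⟨hx.1, ?_⟩
      obtain ⟨hxU, rfl | hx⟩ := hx
      · exact Or.inr huv.symm
      · by_cases hxv : x = v
        · exact Or.inl hxv
        · exact Or.inr (htr v hv u hu x hxU huv.symm hx (Ne.symm hxv))
    exact fun u hu v hv huv => (hsub u hu v hv huv).antisymm (hsub v hv u hu huv.symm)
  have hex : ∀ K : Finset V, ∃ f : V → α, (∃ u ∈ U, K = comp u) →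
      Set.InjOn f K ∧ ∀ u ∈ K, P u (f u) := by
    intro K
    by_cases hK : ∃ u ∈ U, K = comp u
    · obtain ⟨u, hu, rfl⟩ := hK
      obtain ⟨f, hf⟩ := hP (comp u) (hcomp u hu) (fun v hv => (Finset.mem_filter.1 hv).2.1)
        ⟨u, hself u hu⟩
      exact ⟨f, fun _ => hf⟩
    · exact ⟨fun _ => Classical.arbitrary α, fun hh => (hK hh).elim⟩
  choose F hF using hex
  refine ⟨fun u => F (comp u) u, fun u hu => (hF _ ⟨u, hu, rfl⟩).2 u (hself u hu), ?_⟩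
  intro u hu v hv huv hne
  refine huv.ne ((hF (comp u) ⟨u, hu, rfl⟩).1 (hself u hu) ?_ ?_)
  · rw [heq u hu v hv huv]
    exact hself v hv
  · change F (comp u) u = F (comp v) v at hne
    rw [hne, heq u hu v hv huv]

/-- For a vertex with empty trace, the colors of the big-trace vertices adjacent to it; otherwise
the trace. -/
noncomputable def forbiddenColors (G : SimpleGraph V) (Q : Finset V) (u : V) : Finset V :=
  if traceOn G Q u = ∅ then
    Q.filter fun q => ∃ w, Q.card ≤ (traceOn G Q w).card + 1 ∧ G.Adj u w ∧ q ∉ traceOn G Q w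
  else traceOn G Q u

theorem mem_traceOn_of_notMem_forbiddenColors {u w a : V} (hu : τ u = ∅) (ha : a ∈ Q)
    (hau : a ∉ forbiddenColors G Q u) (hw : Q.card ≤ (τ w).card + 1) (huw : G.Adj u w) :
    a ∈ τ w := by
  by_contra haw
  simp only [forbiddenColors, hu, if_true, Finset.mem_filter, not_and] at hau
  exact hau ha ⟨w, hw, huw, haw⟩

theorem traceOn_subset_forbiddenColors (u : V) : τ u ⊆ forbiddenColors G Q u := by
  unfold forbiddenColors
  split
  · next hu => simp [hu]
  · exact subset_rfl

namespace CliqueSetting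

variable (h : CliqueSetting G Q)
include h

theorem colorable_of_small_coloring {k : ℕ} (c : V → V ⊕ Fin k)
    (hc : ∀ u, (τ u).card + 2 ≤ Q.card → ∀ a, c u = .inl a → a ∈ Q ∧ a ∉ τ u)
    (hp : ∀ u v, (τ u).card + 2 ≤ Q.card → (τ v).card + 2 ≤ Q.card → G.Adj u v → c u ≠ c v)
    (hR : ∀ u w, τ u = ∅ → Q.card ≤ (τ w).card + 1 → G.Adj u w → ∀ a, c u = .inl a → a ∈ τ w) :
    G.Colorable (Q.card + k) := by
  choose m hmQ hm using h.exists_notMem_traceOn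
  let d : V → V ⊕ Fin k := fun u => if (τ u).card + 2 ≤ Q.card then c u else .inl (m u)
  have hdsmall : ∀ u, (τ u).card + 2 ≤ Q.card → d u = c u := fun u hu => if_pos hu
  have hdbig : ∀ u, ¬ (τ u).card + 2 ≤ Q.card → d u = .inl (m u) := fun u hu => if_neg hu
  have hbig : ∀ u w, G.Adj u w → ¬ (τ w).card + 2 ≤ Q.card → d u ≠ d w := by
    intro u w huw hw heq
    rw [hdbig w hw] at heq
    have hdu : m w ∉ τ u := by
      by_cases hu : (τ u).card + 2 ≤ Q.card
      · rw [hdsmall u hu] at heq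
        exact (hc u hu _ heq).2
      · rw [hdbig u hu] at heq
        rw [← Sum.inl_injective heq]
        exact hm u
    rcases (τ u).eq_empty_or_nonempty with hu | hu
    · have hus : (τ u).card + 2 ≤ Q.card := by
        have := h.four_le
        rw [hu, Finset.card_empty]
        omega
      rw [hdsmall u hus] at heq
      exact hm w (hR u w hu (by omega) huw _ heq)
    · have := h.union_eq_of_big huw.symm hu (by omega)
      have hmem := hmQ w
      rw [← this, Finset.mem_union] at hmem
      exact hmem.elim (hm w) hdu
  have hdQ : ∀ u a, d u = .inl a → a ∈ Q := by
    intro u a hu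
    by_cases hs : (τ u).card + 2 ≤ Q.card
    · rw [hdsmall u hs] at hu
      exact (hc u hs a hu).1
    · rw [hdbig u hs] at hu
      rw [← Sum.inl_injective hu]
      exact hmQ u
  let e : V → Q ⊕ Fin k := fun u => match hu : d u with
    | .inl a => .inl ⟨a, hdQ u a hu⟩
    | .inr i => .inr i
  have hed : ∀ u, (e u).map (fun x : Q => (x : V)) id = d u := by
    intro u
    simp only [e]
    split
    · next a hu => simp [hu]
    · next i hu => simp [hu]
  have hcol : G.Coloring (Q ⊕ Fin k) := SimpleGraph.Coloring.mk e (by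
    intro u v huv heq
    have hde : d u = d v := by rw [← hed u, ← hed v, heq]
    by_cases hv : (τ v).card + 2 ≤ Q.card
    · by_cases hu : (τ u).card + 2 ≤ Q.card
      · rw [hdsmall u hu, hdsmall v hv] at hde
        exact hp u v hu hv huv hde
      · exact hbig v u huv.symm hu hde.symm
    · exact hbig u v huv hv hde)
  simpa using hcol.colorable

theorem card_forbiddenColors_le {u : V} (hu : τ u = ∅) : (forbiddenColors G Q u).card ≤ 1 := by
  rw [Finset.card_le_one]
  intro p hp q hq
  simp only [forbiddenColors, hu, if_true, Finset.mem_filter] at hp hq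
  obtain ⟨hpQ, v, hv, huv, hpv⟩ := hp
  obtain ⟨hqQ, w, hw, huw, hqw⟩ := hq
  by_contra hpq
  have h4 := h.four_le
  have key : ∀ {x z y : V}, Q.card ≤ (τ x).card + 1 → z ∈ Q → z ∉ τ x → y ∈ Q → y ≠ z →
      y ∈ τ x := by
    intro x z y hx hz hzx hy hyz
    by_contra hyx
    have : insert y (insert z (τ x)) ⊆ Q := by
      simp [Finset.insert_subset_iff, hy, hz, traceOn_subset]
    have := Finset.card_le_card this
    rw [Finset.card_insert_of_notMem (by simp [hyz, hyx]),
      Finset.card_insert_of_notMem hzx] at this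
    omega
  have hqv := key hv hpQ hpv hqQ (Ne.symm hpq)
  have hpw := key hw hqQ hqw hpQ hpq
  obtain ⟨t, htQ, ht⟩ : ∃ t ∈ Q, t ∉ ({p, q} : Finset V) := by
    refine Finset.exists_mem_notMem_of_card_lt_card ?_
    have := Finset.card_le_two (a := p) (b := q)
    omega
  simp only [Finset.mem_insert, Finset.mem_singleton, not_or] at ht
  have htv := key hv hpQ hpv htQ ht.1
  have htw := key hw hqQ hqw htQ ht.2
  rcases h.subset_or_subset_of_adj_empty hu huv huw htv htw with hs | hs
  · exact hqw (hs hqv)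
  · exact hpv (hs hpw)

theorem card_sdiff_forbiddenColors {u : V} (hu : τ u = ∅) :
    Q.card ≤ (Q \ forbiddenColors G Q u).card + 1 := by
  have := h.card_forbiddenColors_le hu
  have := Finset.le_card_sdiff (forbiddenColors G Q u) Q
  omega

theorem exists_injOn_of_eq_or_disjoint {K : Finset V} (hK : G.IsClique (K : Set V))
    (hd : ∀ u ∈ K, ∀ v ∈ K, (τ u).Nonempty → (τ v).Nonempty → τ u = τ v ∨ Disjoint (τ u) (τ v))
    (hR : ∀ v ∈ K, τ v = ∅ → K.card + 1 ≤ Q.card) :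
    ∃ f : V → V, Set.InjOn f K ∧ ∀ u ∈ K, f u ∈ Q \ forbiddenColors G Q u := by
  have h4 := h.four_le
  obtain ⟨q, -⟩ : Q.Nonempty := Finset.card_pos.1 (by omega)
  have : Nonempty V := ⟨q⟩
  have hne : ∀ u : V, (τ u).Nonempty → forbiddenColors G Q u = τ u := fun u hu => by
    rw [forbiddenColors, if_neg hu.ne_empty]
  have hbig : ∀ u ∈ K, ∀ v ∈ K, τ v = ∅ → K.card ≤ (Q \ forbiddenColors G Q v).card := by
    intro u hu v hv hv0
    have := hR v hv hv0
    have := h.card_sdiff_forbiddenColors hv0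
    omega
  refine exists_injOn_of_hall_two K _ ?_ ?_
  · intro u hu
    by_cases hex : ∃ v ∈ K, τ v = ∅ ∧ Q \ forbiddenColors G Q v = Q \ forbiddenColors G Q u
    · obtain ⟨v, hv, hv0, hvu⟩ := hex
      rw [← hvu]
      exact (Finset.card_filter_le _ _).trans (hbig u hu v hv hv0)
    · push Not at hex
      have hu0 : (τ u).Nonempty := by
        by_contra hu0
        exact hex u hu (Finset.not_nonempty_iff_eq_empty.1 hu0) rfl
      have := h.card_add_card_le (S := τ u)
        (K := K.filter fun v => Q \ forbiddenColors G Q v = Q \ forbiddenColors G Q u)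
        (traceOn_subset u) (hK.subset (Finset.coe_subset.2 (Finset.filter_subset _ _))) (by
          intro k hk
          obtain ⟨hkK, hk⟩ := Finset.mem_filter.1 hk
          have hk0 : (τ k).Nonempty := by
            by_contra hk0
            exact hex k hkK (Finset.not_nonempty_iff_eq_empty.1 hk0) hk
          rw [hne u hu0, hne k hk0] at hk
          intro x hx
          by_contra hxk
          have : x ∈ Q \ τ k := Finset.mem_sdiff.2 ⟨traceOn_subset u hx, hxk⟩
          rw [hk] at this
          exact (Finset.mem_sdiff.1 this).2 hx)
      have := Finset.le_card_sdiff (τ u) Q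
      rw [hne u hu0] at *
      omega
  · intro u hu v hv huv
    rcases (τ u).eq_empty_or_nonempty with hu0 | hu0
    · exact (hbig u hu u hu hu0).trans (Finset.card_le_card Finset.subset_union_left)
    rcases (τ v).eq_empty_or_nonempty with hv0 | hv0
    · exact (hbig u hu v hv hv0).trans (Finset.card_le_card Finset.subset_union_right)
    rw [hne u hu0, hne v hv0] at huv ⊢
    rcases hd u hu v hv hu0 hv0 with he | he
    · rw [he] at huv
      exact (huv rfl).elim
    · refine (h.card_le K hK).trans (Finset.card_le_card fun x hx => ?_)
      by_cases hxu : x ∈ τ u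
      · exact Finset.mem_union_right _
          (Finset.mem_sdiff.2 ⟨hx, Finset.disjoint_left.1 he hxu⟩)
      · exact Finset.mem_union_left _ (Finset.mem_sdiff.2 ⟨hx, hxu⟩)

theorem colorable_of_transitive [Fintype V]
    (htr : ∀ u v w, (τ u).card + 2 ≤ Q.card → (τ v).card + 2 ≤ Q.card →
      (τ w).card + 2 ≤ Q.card → G.Adj u v → G.Adj v w → u ≠ w → G.Adj u w)
    (hd : ∀ u v, (τ u).card + 2 ≤ Q.card → (τ v).card + 2 ≤ Q.card → G.Adj u v →
      (τ u).Nonempty → (τ v).Nonempty → τ u = τ v ∨ Disjoint (τ u) (τ v)) :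
    G.Colorable (Q.card + 1) := by
  obtain ⟨c, hc, hcp⟩ := exists_coloring_of_transitive (G := G) (α := V ⊕ Fin 1)
    {u | (τ u).card + 2 ≤ Q.card}
    (fun u hu v hv w hw => htr u v w hu hv hw)
    (fun u x => ∀ a, x = .inl a → a ∈ Q \ forbiddenColors G Q u) (by
      intro K hK hKU hK0
      simp only [Set.mem_ofPred_eq] at hKU
      have hd' : ∀ u ∈ K, ∀ v ∈ K, (τ u).Nonempty → (τ v).Nonempty →
          τ u = τ v ∨ Disjoint (τ u) (τ v) := by
        intro u hu v hv hu0 hv0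
        by_cases huv : u = v
        · exact Or.inl (by rw [huv])
        · exact hd u v (hKU u hu) (hKU v hv) (hK hu hv huv) hu0 hv0
      by_cases hex : ∃ r ∈ K, τ r = ∅
      · obtain ⟨r, hrK, hr⟩ := hex
        have hsub : K.erase r ⊆ K := Finset.erase_subset r K
        obtain ⟨f, hf, hfl⟩ := h.exists_injOn_of_eq_or_disjoint (K := K.erase r)
          (hK.subset (by simp)) (fun u hu v hv => hd' u (hsub hu) v (hsub hv)) (by
            intro v _ _
            have := h.card_le K hK
            have := Finset.card_erase_add_one hrK
            omega)
        refine ⟨fun u => if u = r then .inr 0 else .inl (f u), ?_, ?_⟩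
        · intro x hx y hy hxy
          by_cases hxr : x = r <;> by_cases hyr : y = r <;> simp [hxr, hyr] at hxy ⊢
          exact hf (by simpa [hxr] using hx) (by simpa [hyr] using hy) hxy
        · intro u hu a ha
          by_cases hur : u = r <;> simp [hur] at ha
          exact ha ▸ hfl u (Finset.mem_erase.2 ⟨hur, hu⟩)
      · push Not at hex
        obtain ⟨f, hf, hfl⟩ := h.exists_injOn_of_eq_or_disjoint (K := K) hK hd'
          (fun v hv hv0 => absurd hv0 (hex v hv).ne_empty)
        refine ⟨fun u => .inl (f u), fun x hx y hy hxy => hf hx hy (Sum.inl_injective hxy), ?_⟩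
        intro u hu a ha
        exact Sum.inl_injective ha ▸ hfl u hu)
  refine h.colorable_of_small_coloring c ?_ (fun u v hu hv => hcp u hu v hv) ?_
  · intro u hu a ha
    have := Finset.mem_sdiff.1 (hc u hu a ha)
    exact ⟨this.1, fun hau => this.2 (traceOn_subset_forbiddenColors u hau)⟩
  · intro u w hu hw huw a ha
    have := Finset.mem_sdiff.1 (hc u (by simpa [hu] using (by have := h.four_le; omega)) a ha)
    exact mem_traceOn_of_notMem_forbiddenColors hu this.1 this.2 hw huw

end CliqueSetting

namespace CliqueSetting

variable (h : CliqueSetting G Q)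
include h

theorem adj_of_card_union {r u v : V} (hr : τ r = ∅) (hur : G.Adj u r) (hvr : G.Adj v r)
    (huv : u ≠ v) (hc : (τ u ∪ τ v).card + 2 ≤ Q.card) : G.Adj u v :=
  h.adj_trans_of_subset hc Finset.subset_union_left (by simp [hr]) Finset.subset_union_right
    hur hvr.symm huv

theorem adj_of_traceOn_eq {r u v : V} (hr : τ r = ∅) (hur : G.Adj u r) (hvr : G.Adj v r)
    (huv : u ≠ v) (hu : (τ u).card + 2 ≤ Q.card) (he : τ u = τ v) : G.Adj u v :=
  h.adj_of_card_union hr hur hvr huv (by rwa [← he, Finset.union_self])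

theorem eq_or_disjoint_of_adj_empty {r u v : V} (hr : τ r = ∅) (hur : G.Adj u r)
    (hvr : G.Adj v r) (hu : (τ u).card + 2 ≤ Q.card) (hv : (τ v).card + 2 ≤ Q.card) :
    τ u = τ v ∨ Disjoint (τ u) (τ v) := by
  by_cases hd : Disjoint (τ u) (τ v)
  · exact Or.inr hd
  obtain ⟨q, hqu, hqv⟩ := Finset.not_disjoint_iff.1 hd
  left
  by_cases huv : u = v
  · rw [huv]
  have hcard : (τ u ∪ τ v).card + 2 ≤ Q.card := by
    rcases h.subset_or_subset_of_adj_empty hr hur.symm hvr.symm hqu hqv with hs | hs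
    · rwa [Finset.union_eq_right.2 hs]
    · rwa [Finset.union_eq_left.2 hs]
  rcases h.eq_or_union_eq (h.adj_of_card_union hr hur hvr huv hcard) hqu hqv with he | he
  · exact he
  · rw [he] at hcard
    omega

theorem adj_of_adj_of_traceOn_eq {r u u' v : V} (hr : τ r = ∅) (hur : G.Adj u r)
    (hur' : G.Adj u' r) (hvr : G.Adj v r) (hu : (τ u).card + 2 ≤ Q.card)
    (hu0 : (τ u).Nonempty) (he : τ u = τ u') (hd : Disjoint (τ u) (τ v)) (huv : G.Adj u v) :
    G.Adj u' v := by
  by_contra huv'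
  by_cases huu : u = u'
  · exact huv' (huu ▸ huv)
  obtain ⟨s, hs⟩ := hu0
  have hsQ := mem_of_mem_traceOn hs
  exact no_induced_gem h.gem_free (adj_of_mem_traceOn (he ▸ hs : s ∈ τ u')).symm hur' hvr.symm
    (fun hh => not_adj_of_notMem_traceOn hsQ (by simp [hr]) hh.symm)
    (fun hh => not_adj_of_notMem_traceOn hsQ (Finset.disjoint_left.1 hd hs) hh.symm) huv'
    (adj_of_mem_traceOn hs) (h.adj_of_traceOn_eq hr hur hur' huu hu he) hur huv

theorem adj_or_adj_of_edge_empty {r r' u : V} (hr : τ r = ∅) (hr' : τ r' = ∅)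
    (hrr : G.Adj r r') (hu : u ∉ Q) (hu0 : (τ u).Nonempty) : G.Adj u r ∨ G.Adj u r' := by
  by_contra! hc
  obtain ⟨p, hp⟩ := hu0
  obtain ⟨q, hq, hqu⟩ := h.exists_notMem_traceOn u
  exact hqu (h.mem_traceOn_of_anti hrr hc.1 hc.2 hu hp (by simp [hr]) (by simp [hr']) hq
    (by simp [hr]) (by simp [hr']))

theorem adj_of_edge_empty {r r' u : V} (hr : τ r = ∅) (hr' : τ r' = ∅) (hrr : G.Adj r r')
    (hu : (τ u).card + 2 ≤ Q.card) (hu0 : (τ u).Nonempty) : G.Adj u r := by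
  rcases h.adj_or_adj_of_edge_empty hr hr' hrr (h.notMem_of_small hu) hu0 with hur | hur
  · exact hur
  · refine h.adj_trans_of_subset hu subset_rfl (by simp [hr']) (by simp [hr]) hur hrr.symm ?_
    rintro rfl
    exact hu0.ne_empty hr

theorem colorable_of_edge_empty_of_isClique [Fintype V] {r r' : V} (hr : τ r = ∅)
    (hr' : τ r' = ∅) (hrr : G.Adj r r')
    (hN : ∀ u v, (τ u).card + 2 ≤ Q.card → (τ v).card + 2 ≤ Q.card → (τ u).Nonempty →
      (τ v).Nonempty → u ≠ v → G.Adj u v) : G.Colorable (Q.card + 1) := by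
  have hadj := fun u => h.adj_of_edge_empty (u := u) hr hr' hrr
  have key : ∀ u v w, (τ v).card + 2 ≤ Q.card → (τ w).card + 2 ≤ Q.card → τ u = ∅ →
      G.Adj u v → G.Adj v w → u ≠ w → G.Adj u w := by
    intro u v w hv hw hu0 huv hvw huw
    rcases (τ w).eq_empty_or_nonempty with hw0 | hw0
    · exact h.adj_trans_of_subset hv (by simp [hu0]) subset_rfl (by simp [hw0]) huv hvw huw
    rcases (τ v).eq_empty_or_nonempty with hv0 | hv0
    · exact h.adj_trans_of_subset hw (by simp [hu0]) (by simp [hv0]) subset_rfl huv hvw huw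
    by_cases hur : u = r
    · rw [hur]
      exact (hadj w hw hw0).symm
    · have hur' : G.Adj u r := h.adj_trans_of_subset hv (by simp [hu0]) subset_rfl (by simp [hr])
        huv (hadj v hv hv0) hur
      exact h.adj_trans_of_subset hw (by simp [hu0]) (by simp [hr]) subset_rfl hur'
        (hadj w hw hw0).symm huw
  refine h.colorable_of_transitive ?_ ?_
  · intro u v w hu hv hw huv hvw huw
    rcases (τ u).eq_empty_or_nonempty with hu0 | hu0
    · exact key u v w hv hw hu0 huv hvw huw
    rcases (τ w).eq_empty_or_nonempty with hw0 | hw0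
    · exact (key w v u hv hu hw0 hvw.symm huv.symm huw.symm).symm
    · exact hN u w hu hw hu0 hw0 huw
  · intro u v hu hv _ hu0 hv0
    exact h.eq_or_disjoint_of_adj_empty hr (hadj u hu hu0) (hadj v hv hv0) hu hv

omit h in
theorem _root_.exists_injOn_sum {α β : Type*} (K : Finset α) (D : Finset β) (k : ℕ)
    (hKD : K.card ≤ D.card) (hD : D.Nonempty) : ∃ D' ⊆ D, D'.card ≤ K.card - k ∧
      ∃ g : α → β ⊕ Fin k, Set.InjOn g K ∧ ∀ u ∈ K, ∀ a, g u = .inl a → a ∈ D' := by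
  obtain ⟨D', hD', hcard⟩ := Finset.exists_subset_card_eq (s := D) (n := K.card - k) (by omega)
  have : Nonempty (β ⊕ Fin k) := ⟨.inl hD.choose⟩
  obtain ⟨g, hg, hgl⟩ := exists_injOn_of_card_le K
    (fun _ => D'.disjSum (Finset.univ : Finset (Fin k))) (by
      intro u _
      rw [Finset.card_disjSum, hcard, Finset.card_univ, Fintype.card_fin]
      omega)
  refine ⟨D', hD', hcard.le, g, hg, fun u hu a ha => ?_⟩
  have := hgl u hu
  rwa [ha, Finset.inl_mem_disjSum] at this

/-- The component, among the vertices without neighbours in `Q`, of such a vertex `r`. -/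
noncomputable def _root_.emptyComponent [Fintype V] (G : SimpleGraph V) (Q : Finset V) (r : V) :
    Finset V :=
  Finset.univ.filter fun x => traceOn G Q x = ∅ ∧ (x = r ∨ G.Adj x r)

omit h in
theorem _root_.mem_emptyComponent [Fintype V] {r x : V} :
    x ∈ emptyComponent G Q r ↔ τ x = ∅ ∧ (x = r ∨ G.Adj x r) := by
  simp [emptyComponent]

section EmptyComponent

variable [Fintype V] {r r' : V} (hr : traceOn G Q r = ∅) (hr' : traceOn G Q r' = ∅)
  (hrr : G.Adj r r')
include hr

theorem isClique_emptyComponent : G.IsClique (emptyComponent G Q r : Set V) := by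
  intro x hx y hy hxy
  have h4 := h.four_le
  rw [Finset.mem_coe, mem_emptyComponent] at hx hy
  obtain ⟨hx0, rfl | hx⟩ := hx <;> obtain ⟨hy0, rfl | hy⟩ := hy
  · exact (hxy rfl).elim
  · exact hy.symm
  · exact hx
  · exact h.adj_trans_of_subset (S := ∅) (by simp; omega) (by simp [hx0]) (by simp [hr])
      (by simp [hy0]) hx hy.symm hxy

theorem mem_emptyComponent_of_adj {x y : V} (hx : x ∈ emptyComponent G Q r) (hy : τ y = ∅)
    (hxy : G.Adj x y) : y ∈ emptyComponent G Q r := by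
  have h4 := h.four_le
  rw [mem_emptyComponent] at hx ⊢
  refine ⟨hy, ?_⟩
  by_cases hyr : y = r
  · exact Or.inl hyr
  obtain ⟨hx0, rfl | hx⟩ := hx
  · exact Or.inr hxy.symm
  · exact Or.inr (h.adj_trans_of_subset (S := ∅) (by simp; omega) (by simp [hy]) (by simp [hx0])
      (by simp [hr]) hxy.symm hx hyr)

include hr' hrr

theorem adj_of_mem_emptyComponent {x u : V} (hx : x ∈ emptyComponent G Q r)
    (hu : (τ u).card + 2 ≤ Q.card) (hu0 : (τ u).Nonempty) : G.Adj x u := by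
  rw [mem_emptyComponent] at hx
  have hur := h.adj_of_edge_empty hr hr' hrr hu hu0
  obtain ⟨hx0, rfl | hx⟩ := hx
  · exact hur.symm
  · refine h.adj_trans_of_subset hu (by simp [hx0]) (by simp [hr]) subset_rfl hx hur.symm ?_
    rintro rfl
    exact hu0.ne_empty hx0

theorem not_adj_of_notMem_emptyComponent {x y w : V} (hx0 : τ x = ∅)
    (hx : x ∉ emptyComponent G Q r) (hy : (τ y).card + 2 ≤ Q.card)
    (hw : (τ w).card + 2 ≤ Q.card) (hw0 : (τ w).Nonempty) : ¬ G.Adj x y := by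
  have key : ∀ {z : V}, (τ z).card + 2 ≤ Q.card → (τ z).Nonempty → ¬ G.Adj x z := by
    intro z hz hz0 hxz
    refine hx (mem_emptyComponent.2 ⟨hx0, ?_⟩)
    by_cases hxr : x = r
    · exact Or.inl hxr
    · exact Or.inr (h.adj_trans_of_subset hz (by simp [hx0]) subset_rfl (by simp [hr]) hxz
        (h.adj_of_edge_empty hr hr' hrr hz hz0) hxr)
  rcases (τ y).eq_empty_or_nonempty with hy0 | hy0
  · exact fun hxy => key hw hw0 (h.adj_of_edge_empty hx0 hy0 hxy hw hw0).symm
  · exact key hy hy0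

theorem card_emptyComponent_add_card_le {K : Finset V} (hK : G.IsClique (K : Set V))
    (hKs : ∀ u ∈ K, (τ u).card + 2 ≤ Q.card ∧ (τ u).Nonempty) :
    (emptyComponent G Q r).card + K.card ≤ Q.card := by
  have hadj : ∀ x ∈ emptyComponent G Q r, ∀ u ∈ K, G.Adj x u := fun x hx u hu =>
    h.adj_of_mem_emptyComponent hr hr' hrr hx (hKs u hu).1 (hKs u hu).2
  rw [← Finset.card_union_of_disjoint
    (Finset.disjoint_left.2 fun x hx hxK => G.irrefl (hadj x hx x hxK))]
  refine h.card_le _ fun x hx y hy hxy => ?_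
  simp only [Finset.coe_union, Set.mem_union, Finset.mem_coe] at hx hy
  rcases hx with hx | hx <;> rcases hy with hy | hy
  · exact h.isClique_emptyComponent hr hx hy hxy
  · exact hadj x hx y hy
  · exact (hadj y hy x hx).symm
  · exact hK hx hy hxy

end EmptyComponent

end CliqueSetting

namespace CliqueSetting

variable (h : CliqueSetting G Q)
include h

variable {r r' : V} (hr : traceOn G Q r = ∅) (hr' : traceOn G Q r' = ∅)
  (hrr : G.Adj r r')
include hr hr' hrr

theorem isClique_of_traceOn_eq [Fintype V] {S : Finset V} (hS : S.card + 2 ≤ Q.card)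
    (hS0 : S.Nonempty) :
    G.IsClique ((Finset.univ.filter fun u => τ u = S : Finset V) : Set V) := by
  intro u hu v hv huv
  simp only [Finset.coe_filter, Finset.mem_univ, true_and, Set.mem_ofPred_eq] at hu hv
  exact h.adj_of_traceOn_eq hr (h.adj_of_edge_empty hr hr' hrr (by rwa [hu]) (by rwa [hu]))
    (h.adj_of_edge_empty hr hr' hrr (by rwa [hv]) (by rwa [hv])) huv (by rwa [hu])
    (hu.trans hv.symm)

theorem not_adj_of_traceOn_eq {u v x y : V} (hu : (τ u).card + 2 ≤ Q.card)
    (hv : (τ v).card + 2 ≤ Q.card) (hu0 : (τ u).Nonempty) (hv0 : (τ v).Nonempty)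
    (huv : ¬ G.Adj u v) (hd : Disjoint (τ u) (τ v)) (hx : τ x = τ u) (hy : τ y = τ v) :
    ¬ G.Adj x y := by
  intro hxy
  have hadj := fun u => h.adj_of_edge_empty (u := u) hr hr' hrr
  have hur := hadj u hu hu0
  have hvr := hadj v hv hv0
  have hxr := hadj x (by rwa [hx]) (by rwa [hx])
  have hyr := hadj y (by rwa [hy]) (by rwa [hy])
  have h1 := h.adj_of_adj_of_traceOn_eq hr hxr hur hyr (by rwa [hx]) (by rwa [hx]) hx
    (by rwa [hx, hy]) hxy
  exact huv (h.adj_of_adj_of_traceOn_eq hr hyr hvr hur (by rwa [hy]) (by rwa [hy]) hy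
    (by rw [hy]; exact hd.symm) h1.symm).symm

theorem colorable_of_edge_empty_of_cover [Fintype V] {k : ℕ} (hk : Q.card ≤ 4 * k + 1) {u v : V}
    (hu : (τ u).card + 2 ≤ Q.card) (hv : (τ v).card + 2 ≤ Q.card) (hu0 : (τ u).Nonempty)
    (hv0 : (τ v).Nonempty) (huv : ¬ G.Adj u v) (hd : Disjoint (τ u) (τ v))
    (hcov : τ u ∪ τ v = Q) : G.Colorable (Q.card + k) := by
  have h4 := h.four_le
  have hadj := fun u => h.adj_of_edge_empty (u := u) hr hr' hrr
  have hsum : (τ u).card + (τ v).card = Q.card := by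
    rw [← Finset.card_union_of_disjoint hd, hcov]
  obtain ⟨q₀, hq₀⟩ : Q.Nonempty := Finset.card_pos.1 (by omega)
  have : Nonempty V := ⟨q₀⟩
  have htr : ∀ x, (τ x).card + 2 ≤ Q.card → (τ x).Nonempty → τ x = τ u ∨ τ x = τ v := by
    intro x hx hx0
    rcases h.eq_or_disjoint_of_adj_empty hr (hadj x hx hx0) (hadj u hu hu0) hx hu with he | he
    · exact Or.inl he
    rcases h.eq_or_disjoint_of_adj_empty hr (hadj x hx hx0) (hadj v hv hv0) hx hv with he' | he'
    · exact Or.inr he'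
    obtain ⟨p, hp⟩ := hx0
    have hpQ := mem_of_mem_traceOn hp
    rw [← hcov, Finset.mem_union] at hpQ
    exact (hpQ.elim (Finset.disjoint_left.1 he hp) (Finset.disjoint_left.1 he' hp)).elim
  have hbig : ∀ w x, τ w = ∅ → Q.card ≤ (τ x).card + 1 → ¬ G.Adj w x := by
    intro w x hw hx hwx
    have hxQ : x ∉ Q := fun hxQ => not_adj_of_notMem_traceOn hxQ (by simp [hw]) hwx
    obtain ⟨s, hs, hxs⟩ : ∃ s, τ s = ∅ ∧ G.Adj s x ∧ G.Adj s u ∧ G.Adj s v := by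
      have hx0 : (τ x).Nonempty := Finset.card_pos.1 (by omega)
      rcases h.adj_or_adj_of_edge_empty hr hr' hrr hxQ hx0 with hxr | hxr
      · exact ⟨r, hr, hxr.symm, (hadj u hu hu0).symm, (hadj v hv hv0).symm⟩
      · exact ⟨r', hr', hxr.symm, (h.adj_of_edge_empty hr' hr hrr.symm hu hu0).symm,
          (h.adj_of_edge_empty hr' hr hrr.symm hv hv0).symm⟩
    have key : ∀ y, (τ y).card + 2 ≤ Q.card → 2 ≤ (τ y).card → G.Adj s y → τ y ⊆ τ x := by
      intro y hy hy2 hsy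
      obtain ⟨q, hqx, hqy⟩ : ∃ q, q ∈ τ x ∧ q ∈ τ y := by
        by_contra! hc
        have hd := Finset.card_union_of_disjoint (Finset.disjoint_left.2 hc)
        have := Finset.card_le_card (traceOn_union_subset (G := G) (Q := Q) x y)
        omega
      rcases h.subset_or_subset_of_adj_empty hs hxs.1 hsy hqx hqy with hss | hss
      · have := Finset.card_le_card hss
        omega
      · exact hss
    have := Finset.card_le_card (Finset.union_subset (key u hu (by omega) hxs.2.1)
      (key v hv (by omega) hxs.2.2))
    rw [hcov] at this
    have := h.card_traceOn_lt x
    omega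
  let K : V → Finset V := fun y => Finset.univ.filter fun x => τ x = τ y
  have hKu : G.IsClique (K u : Set V) := h.isClique_of_traceOn_eq hr hr' hrr hu hu0
  have hKv : G.IsClique (K v : Set V) := h.isClique_of_traceOn_eq hr hr' hrr hv hv0
  have hmemK : ∀ {x y}, x ∈ K y ↔ τ x = τ y := by simp [K]
  have hcu : (τ u).card + (K u).card ≤ Q.card := h.card_add_card_le (traceOn_subset u) hKu
    fun x hx => (hmemK.1 hx).ge
  have hcv : (τ v).card + (K v).card ≤ Q.card := h.card_add_card_le (traceOn_subset v) hKv
    fun x hx => (hmemK.1 hx).ge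
  have heu := h.card_emptyComponent_add_card_le hr hr' hrr hKu
    fun x hx => by rw [hmemK.1 hx]; exact ⟨hu, hu0⟩
  have hev := h.card_emptyComponent_add_card_le hr hr' hrr hKv
    fun x hx => by rw [hmemK.1 hx]; exact ⟨hv, hv0⟩
  obtain ⟨Du, hDu, hDuc, gu, hgu, hgul⟩ := exists_injOn_sum (K u) (τ v) k (by omega) hv0
  obtain ⟨Dv, hDv, hDvc, gv, hgv, hgvl⟩ := exists_injOn_sum (K v) (τ u) k (by omega) hu0
  obtain ⟨f, hf, hfl⟩ := exists_injOn_of_card_le (emptyComponent G Q r)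
    (fun _ => Q \ (Du ∪ Dv)) (by
      intro _ _
      have h1 := Finset.le_card_sdiff (Du ∪ Dv) Q
      have h2 := Finset.card_union_le Du Dv
      omega)
  have hne : τ u ≠ τ v := fun he => by
    rw [he, Finset.disjoint_self_iff_empty] at hd
    exact hv0.ne_empty hd
  let c : V → V ⊕ Fin k := fun x => if τ x = τ u then gu x else if τ x = τ v then gv x else
    if x ∈ emptyComponent G Q r then .inl (f x) else .inl q₀
  have hcu' : ∀ x, τ x = τ u → c x = gu x := fun x hx => if_pos hx
  have hcv' : ∀ x, τ x = τ v → c x = gv x := fun x hx => by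
    simp only [c, hx, hne.symm, if_true, if_false]
  have hcr' : ∀ x ∈ emptyComponent G Q r, c x = .inl (f x) := fun x hx => by
    have hx0 := (mem_emptyComponent.1 hx).1
    simp only [c, hx0, hu0.ne_empty.symm, hv0.ne_empty.symm, hx, if_true, if_false]
  have hci' : ∀ x, τ x = ∅ → x ∉ emptyComponent G Q r → c x = .inl q₀ := fun x hx0 hx => by
    simp only [c, hx0, hu0.ne_empty.symm, hv0.ne_empty.symm, hx, if_false]
  have hcases : ∀ x, (τ x).card + 2 ≤ Q.card → τ x = τ u ∨ τ x = τ v ∨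
      (x ∈ emptyComponent G Q r) ∨ (τ x = ∅ ∧ x ∉ emptyComponent G Q r) := by
    intro x hx
    by_cases hx0 : (τ x).Nonempty
    · have := htr x hx hx0
      tauto
    · have := Finset.not_nonempty_iff_eq_empty.1 hx0
      tauto
  refine h.colorable_of_small_coloring c ?_ ?_ ?_
  · intro x hx a ha
    rcases hcases x hx with hxu | hxv | hxr | ⟨hx0, hxr⟩
    · rw [hcu' x hxu] at ha
      have := hDu (hgul x (hmemK.2 hxu) a ha)
      rw [hxu]
      exact ⟨mem_of_mem_traceOn this, Finset.disjoint_right.1 hd this⟩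
    · rw [hcv' x hxv] at ha
      have := hDv (hgvl x (hmemK.2 hxv) a ha)
      rw [hxv]
      exact ⟨mem_of_mem_traceOn this, Finset.disjoint_left.1 hd this⟩
    · rw [hcr' x hxr] at ha
      obtain rfl := Sum.inl_injective ha
      simp [(mem_emptyComponent.1 hxr).1, (Finset.mem_sdiff.1 (hfl x hxr)).1]
    · rw [hci' x hx0 hxr] at ha
      obtain rfl := Sum.inl_injective ha
      simp [hx0, hq₀]
  · have hUV : ∀ x y, τ x = τ u → τ y = τ v → ¬ G.Adj x y := fun x y hx hy =>
      h.not_adj_of_traceOn_eq hr hr' hrr hu hv hu0 hv0 huv hd hx hy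
    have hUR : ∀ x y, τ x = τ u → y ∈ emptyComponent G Q r → c x ≠ c y := by
      intro x y hx hy he
      rw [hcu' x hx, hcr' y hy] at he
      have := Finset.mem_sdiff.1 (hfl y hy)
      exact this.2 (Finset.mem_union_left _ (hgul x (hmemK.2 hx) _ he))
    have hVR : ∀ x y, τ x = τ v → y ∈ emptyComponent G Q r → c x ≠ c y := by
      intro x y hx hy he
      rw [hcv' x hx, hcr' y hy] at he
      have := Finset.mem_sdiff.1 (hfl y hy)
      exact this.2 (Finset.mem_union_right _ (hgvl x (hmemK.2 hx) _ he))
    have hI : ∀ x y, (τ y).card + 2 ≤ Q.card → τ x = ∅ → x ∉ emptyComponent G Q r →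
        ¬ G.Adj x y := fun x y hy hx0 hx =>
      h.not_adj_of_notMem_emptyComponent hr hr' hrr hx0 hx hy hu hu0
    intro x y hx hy hxy
    rcases hcases x hx with hxu | hxv | hxr | ⟨hx0, hxr⟩
    · rcases hcases y hy with hyu | hyv | hyr | ⟨hy0, hyr⟩
      · rw [hcu' x hxu, hcu' y hyu]
        exact fun he => hxy.ne (hgu (hmemK.2 hxu) (hmemK.2 hyu) he)
      · exact (hUV x y hxu hyv hxy).elim
      · exact hUR x y hxu hyr
      · exact (hI y x hx hy0 hyr hxy.symm).elim
    · rcases hcases y hy with hyu | hyv | hyr | ⟨hy0, hyr⟩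
      · exact (hUV y x hyu hxv hxy.symm).elim
      · rw [hcv' x hxv, hcv' y hyv]
        exact fun he => hxy.ne (hgv (hmemK.2 hxv) (hmemK.2 hyv) he)
      · exact hVR x y hxv hyr
      · exact (hI y x hx hy0 hyr hxy.symm).elim
    · rcases hcases y hy with hyu | hyv | hyr | ⟨hy0, hyr⟩
      · exact (hUR y x hyu hxr).symm
      · exact (hVR y x hyv hxr).symm
      · rw [hcr' x hxr, hcr' y hyr]
        exact fun he => hxy.ne (hf hxr hyr (Sum.inl_injective he))
      · exact (hI y x hx hy0 hyr hxy.symm).elim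
    · exact (hI x y hy hx0 hxr hxy).elim
  · intro x w hx hw hxw
    exact (hbig x w hx hw hxw).elim

theorem colorable_of_edge_empty_of_union_erase [Fintype V] {q u v : V}
    (hu : (τ u).card + 3 ≤ Q.card) (hv : (τ v).card + 2 ≤ Q.card) (hu0 : (τ u).Nonempty)
    (hv0 : (τ v).Nonempty) (huv : ¬ G.Adj u v) (hne : u ≠ v) (hd : Disjoint (τ u) (τ v))
    (hq : q ∈ Q) (hcov : τ u ∪ τ v = Q.erase q) : G.Colorable (Q.card + 1) := by
  have h4 := h.four_le
  have : Nonempty V := ⟨q⟩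
  have hadj := fun u => h.adj_of_edge_empty (u := u) hr hr' hrr
  have hu2 : (τ u).card + 2 ≤ Q.card := by omega
  have hqu : q ∉ τ u := fun hqu => by
    have := Finset.mem_union_left (τ v) hqu
    simp [hcov] at this
  have hqv : q ∉ τ v := fun hqv => by
    have := Finset.mem_union_right (τ u) hqv
    simp [hcov] at this
  have htr : ∀ x, (τ x).card + 2 ≤ Q.card → (τ x).Nonempty →
      τ x = τ u ∨ τ x = τ v ∨ τ x = {q} := by
    intro x hx hx0
    rcases h.eq_or_disjoint_of_adj_empty hr (hadj x hx hx0) (hadj u hu2 hu0) hx hu2 with he | he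
    · exact Or.inl he
    rcases h.eq_or_disjoint_of_adj_empty hr (hadj x hx hx0) (hadj v hv hv0) hx hv with he' | he'
    · exact Or.inr (Or.inl he')
    refine Or.inr (Or.inr (Finset.eq_singleton_iff_nonempty_unique_mem.2 ⟨hx0, fun p hp => ?_⟩))
    by_contra hpq
    have hpQ := Finset.mem_erase.2 ⟨hpq, mem_of_mem_traceOn hp⟩
    rw [← hcov, Finset.mem_union] at hpQ
    exact hpQ.elim (Finset.disjoint_left.1 he hp) (Finset.disjoint_left.1 he' hp)
  have huniq : ∀ {u v : V}, (τ u).card + 2 ≤ Q.card → (τ v).card + 2 ≤ Q.card →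
      (τ u).Nonempty → (τ v).Nonempty → ¬ G.Adj u v → Disjoint (τ u) (τ v) →
      q ∉ τ u → q ∉ τ v → ∀ x, τ x = τ u → x = u := by
    intro u v hu hv hu0 hv0 huv hd hqu hqv x hx
    by_contra hxu
    have hxv : ¬ G.Adj v x := fun hvx =>
      h.not_adj_of_traceOn_eq hr hr' hrr hu hv hu0 hv0 huv hd hx rfl hvx.symm
    have hxu' : G.Adj x u := h.adj_of_traceOn_eq hr (hadj x (by rwa [hx]) (by rwa [hx]))
      (hadj u hu hu0) hxu (by rwa [hx]) hx
    obtain ⟨p, hp⟩ := hv0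
    exact hqv (h.mem_traceOn_of_anti hxu' hxv (fun hh => huv hh.symm) (h.notMem_of_small hv) hp
      (by rw [hx]; exact Finset.disjoint_right.1 hd hp) (Finset.disjoint_right.1 hd hp) hq
      (by rwa [hx]) hqu)
  have huu := huniq hu2 hv hu0 hv0 huv hd hqu hqv
  have hvv := huniq hv hu2 hv0 hu0 (fun hh => huv hh.symm) hd.symm hqv hqu
  let Nq : Finset V := Finset.univ.filter fun x => τ x = {q}
  have hmemN : ∀ {x}, x ∈ Nq ↔ τ x = {q} := by simp [Nq]
  have hNs : ∀ x ∈ Nq, (τ x).card + 2 ≤ Q.card ∧ (τ x).Nonempty := by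
    intro x hx
    rw [hmemN.1 hx]
    simp
    omega
  have huN : u ∉ Nq := fun hh => by simp [hmemN.1 hh] at hqu
  have hNu : ∀ x ∈ Nq, G.Adj u x := by
    intro x hx
    refine h.adj_of_card_union hr (hadj u hu2 hu0) (hadj x (hNs x hx).1 (hNs x hx).2) ?_ ?_
    · rintro rfl
      exact huN hx
    · have := Finset.card_union_le (τ u) (τ x)
      rw [hmemN.1 hx] at this ⊢
      simp only [Finset.card_singleton] at this
      omega
  have hNc : G.IsClique (Nq : Set V) := h.isClique_of_traceOn_eq hr hr' hrr
    (by simp; omega) (by simp)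
  have hKcard := h.card_emptyComponent_add_card_le hr hr' hrr (K := insert u Nq)
    (by
      rw [Finset.coe_insert]
      exact hNc.insert fun x hx _ => hNu x hx)
    (by
      intro x hx
      rcases Finset.mem_insert.1 hx with rfl | hx
      · exact ⟨hu2, hu0⟩
      · exact hNs x hx)
  rw [Finset.card_insert_of_notMem huN] at hKcard
  have hrc : r ∈ emptyComponent G Q r := mem_emptyComponent.2 ⟨hr, Or.inl rfl⟩
  have hrcard := Finset.card_erase_add_one hrc
  obtain ⟨f, hf, hfl⟩ := exists_injOn_of_card_le ((emptyComponent G Q r).erase r ∪ Nq)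
    (fun x => (Q.erase q) \ (forbiddenColors G Q x \ {q})) (by
      intro x hx
      have h1 := Finset.le_card_sdiff (forbiddenColors G Q x \ {q}) (Q.erase q)
      have h2 := Finset.card_union_le ((emptyComponent G Q r).erase r) Nq
      have h3 := Finset.card_erase_add_one hq
      have h5 : (forbiddenColors G Q x \ {q}).card ≤ 1 := by
        refine (Finset.card_le_card Finset.sdiff_subset).trans ?_
        rcases Finset.mem_union.1 hx with hx | hx
        · exact h.card_forbiddenColors_le (mem_emptyComponent.1 (Finset.mem_erase.1 hx).2).1
        · rw [forbiddenColors, if_neg (hNs x hx).2.ne_empty, hmemN.1 hx, Finset.card_singleton]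
      omega)
  have hfq : ∀ x ∈ (emptyComponent G Q r).erase r ∪ Nq,
      f x ∈ Q ∧ f x ≠ q ∧ f x ∉ forbiddenColors G Q x := by
    intro x hx
    have := hfl x hx
    simp only [Finset.mem_sdiff, Finset.mem_erase, Finset.mem_singleton] at this
    tauto
  let c : V → V ⊕ Fin 1 := fun x => if x ∈ (emptyComponent G Q r).erase r ∪ Nq then .inl (f x)
    else if τ x = ∅ then .inr 0 else .inl q
  have hcf : ∀ x ∈ (emptyComponent G Q r).erase r ∪ Nq, c x = .inl (f x) := fun x hx => if_pos hx
  have hcr : ∀ x, x ∉ (emptyComponent G Q r).erase r ∪ Nq → τ x = ∅ → c x = .inr 0 :=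
    fun x hx hx0 => by simp only [c, hx, hx0, if_true, if_false]
  have hcq : ∀ x, x ∉ (emptyComponent G Q r).erase r ∪ Nq → (τ x).Nonempty → c x = .inl q :=
    fun x hx hx0 => by simp only [c, hx, hx0.ne_empty, if_false]
  have hxuv : ∀ x, (τ x).card + 2 ≤ Q.card → x ∉ (emptyComponent G Q r).erase r ∪ Nq →
      (τ x).Nonempty → x = u ∨ x = v := by
    intro x hx hxn hx0
    rw [Finset.mem_union, hmemN] at hxn
    have := htr x hx hx0
    have := huu x
    have := hvv x
    tauto
  refine h.colorable_of_small_coloring c ?_ ?_ ?_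
  · intro x hx a ha
    by_cases hxn : x ∈ (emptyComponent G Q r).erase r ∪ Nq
    · rw [hcf x hxn] at ha
      obtain rfl := Sum.inl_injective ha
      exact ⟨(hfq x hxn).1, fun hh => (hfq x hxn).2.2 (traceOn_subset_forbiddenColors x hh)⟩
    rcases (τ x).eq_empty_or_nonempty with hx0 | hx0
    · rw [hcr x hxn hx0] at ha
      exact (Sum.inr_ne_inl ha).elim
    · rw [hcq x hxn hx0] at ha
      obtain rfl := Sum.inl_injective ha
      rcases hxuv x hx hxn hx0 with rfl | rfl
      · exact ⟨hq, hqu⟩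
      · exact ⟨hq, hqv⟩
  · have hclq : G.IsClique (((emptyComponent G Q r).erase r ∪ Nq : Finset V) : Set V) := by
      intro x hx y hy hxy
      simp only [Finset.coe_union, Set.mem_union, Finset.mem_coe, Finset.mem_erase] at hx hy
      rcases hx with hx | hx <;> rcases hy with hy | hy
      · exact h.isClique_emptyComponent hr hx.2 hy.2 hxy
      · exact h.adj_of_mem_emptyComponent hr hr' hrr hx.2 (hNs y hy).1 (hNs y hy).2
      · exact (h.adj_of_mem_emptyComponent hr hr' hrr hy.2 (hNs x hx).1 (hNs x hx).2).symm
      · exact hNc hx hy hxy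
    have key : ∀ x y, (τ x).card + 2 ≤ Q.card → (τ y).card + 2 ≤ Q.card →
        y ∉ (emptyComponent G Q r).erase r ∪ Nq → G.Adj x y → c x ≠ c y := by
      intro x y hx hy hyn hxy he
      rcases (τ y).eq_empty_or_nonempty with hy0 | hy0
      · rw [hcr y hyn hy0] at he
        by_cases hxn : x ∈ (emptyComponent G Q r).erase r ∪ Nq
        · rw [hcf x hxn] at he
          exact Sum.inl_ne_inr he
        rcases (τ x).eq_empty_or_nonempty with hx0 | hx0
        · by_cases hyr : y ∈ emptyComponent G Q r
          · have hxr := h.mem_emptyComponent_of_adj hr hyr hx0 hxy.symm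
            have h1 : y = r := by
              by_contra h1
              exact hyn (Finset.mem_union_left _ (Finset.mem_erase.2 ⟨h1, hyr⟩))
            have h2 : x = r := by
              by_contra h2
              exact hxn (Finset.mem_union_left _ (Finset.mem_erase.2 ⟨h2, hxr⟩))
            exact hxy.ne (h2.trans h1.symm)
          · exact h.not_adj_of_notMem_emptyComponent hr hr' hrr hy0 hyr hx hu2 hu0 hxy.symm
        · rw [hcq x hxn hx0] at he
          exact Sum.inl_ne_inr he
      · rw [hcq y hyn hy0] at he
        by_cases hxn : x ∈ (emptyComponent G Q r).erase r ∪ Nq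
        · rw [hcf x hxn] at he
          exact (hfq x hxn).2.1 (Sum.inl_injective he)
        rcases (τ x).eq_empty_or_nonempty with hx0 | hx0
        · rw [hcr x hxn hx0] at he
          exact Sum.inr_ne_inl he
        · rcases hxuv x hx hxn hx0 with rfl | rfl <;> rcases hxuv y hy hyn hy0 with rfl | rfl
          · exact hxy.ne rfl
          · exact huv hxy
          · exact huv hxy.symm
          · exact hxy.ne rfl
    intro x y hx hy hxy
    by_cases hyn : y ∈ (emptyComponent G Q r).erase r ∪ Nq
    · by_cases hxn : x ∈ (emptyComponent G Q r).erase r ∪ Nq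
      · rw [hcf x hxn, hcf y hyn]
        exact fun he => hxy.ne (hf hxn hyn (Sum.inl_injective he))
      · exact (key y x hy hx hxn hxy.symm).symm
    · exact key x y hx hy hyn hxy
  · intro x w hx0 hw hxw a ha
    by_cases hxn : x ∈ (emptyComponent G Q r).erase r ∪ Nq
    · rw [hcf x hxn] at ha
      obtain rfl := Sum.inl_injective ha
      exact mem_traceOn_of_notMem_forbiddenColors hx0 (hfq x hxn).1 (hfq x hxn).2.2 hw hxw
    · rw [hcr x hxn hx0] at ha
      exact (Sum.inr_ne_inl ha).elim

theorem colorable_of_edge_empty [Fintype V] {k : ℕ} (hk : Q.card ≤ 4 * k + 1) :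
    G.Colorable (Q.card + k) := by
  have h4 := h.four_le
  have hadj := fun u => h.adj_of_edge_empty (u := u) hr hr' hrr
  have hmono : G.Colorable (Q.card + 1) → G.Colorable (Q.card + k) := fun hh =>
    hh.mono (by omega)
  by_cases hN : ∀ u v, (τ u).card + 2 ≤ Q.card → (τ v).card + 2 ≤ Q.card → (τ u).Nonempty →
      (τ v).Nonempty → u ≠ v → G.Adj u v
  · exact hmono (h.colorable_of_edge_empty_of_isClique hr hr' hrr hN)
  push Not at hN
  obtain ⟨u, v, hu, hv, hu0, hv0, hne, huv⟩ := hN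
  have hd : Disjoint (τ u) (τ v) := by
    rcases h.eq_or_disjoint_of_adj_empty hr (hadj u hu hu0) (hadj v hv hv0) hu hv with he | he
    · exact (huv (h.adj_of_traceOn_eq hr (hadj u hu hu0) (hadj v hv hv0) hne hu he)).elim
    · exact he
  have hcard : Q.card ≤ (τ u ∪ τ v).card + 1 := by
    by_contra hc
    exact huv (h.adj_of_card_union hr (hadj u hu hu0) (hadj v hv hv0) hne (by omega))
  have hsub := traceOn_union_subset (G := G) (Q := Q) u v
  by_cases hcov : τ u ∪ τ v = Q
  · exact h.colorable_of_edge_empty_of_cover hr hr' hrr hk hu hv hu0 hv0 huv hd hcov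
  obtain ⟨q, hq, hquv⟩ := Finset.exists_of_ssubset (hsub.ssubset_of_ne hcov)
  have hcov' : τ u ∪ τ v = Q.erase q := by
    refine Finset.eq_of_subset_of_card_le (Finset.subset_erase.2 ⟨hsub, hquv⟩) ?_
    rw [Finset.card_erase_of_mem hq]
    omega
  have hsum : (τ u).card + (τ v).card + 1 = Q.card := by
    rw [← Finset.card_union_of_disjoint hd, hcov', Finset.card_erase_add_one hq]
  refine hmono ?_
  by_cases hu3 : (τ u).card + 3 ≤ Q.card
  · exact h.colorable_of_edge_empty_of_union_erase hr hr' hrr hu3 hv hu0 hv0 huv hne hd hq hcov'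
  · exact h.colorable_of_edge_empty_of_union_erase hr hr' hrr (by omega) hu hv0 hu0
      (fun hh => huv hh.symm) hne.symm hd.symm hq (by rwa [Finset.union_comm])

end CliqueSetting

/-- The vertices whose trace on `Q` is nonempty and contained in `S`. -/
def traceSide (G : SimpleGraph V) (Q S : Finset V) : Set V :=
  {u | (traceOn G Q u).Nonempty ∧ traceOn G Q u ⊆ S}

theorem mem_traceSide {S : Finset V} {u : V} :
    u ∈ traceSide G Q S ↔ (τ u).Nonempty ∧ τ u ⊆ S := Iff.rfl

namespace CliqueSetting

variable (h : CliqueSetting G Q)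
include h

theorem eq_or_disjoint_of_adj {S : Finset V} (hS : S.card + 2 ≤ Q.card) {u v : V}
    (hu : τ u ⊆ S) (hv : τ v ⊆ S) (huv : G.Adj u v) : τ u = τ v ∨ Disjoint (τ u) (τ v) := by
  by_cases hd : Disjoint (τ u) (τ v)
  · exact Or.inr hd
  obtain ⟨q, hqu, hqv⟩ := Finset.not_disjoint_iff.1 hd
  rcases h.eq_or_union_eq huv hqu hqv with he | he
  · exact Or.inl he
  · have := Finset.card_le_card (Finset.union_subset hu hv)
    rw [he] at this
    omega

theorem exists_coloring_of_card_le [Fintype V] {S D : Finset V} (hS : S.card + 2 ≤ Q.card)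
    {U : Set V} (hU : ∀ u ∈ U, τ u ⊆ S)
    (hD : ∀ K : Finset V, G.IsClique (K : Set V) → (∀ u ∈ K, u ∈ U) → K.card ≤ D.card) :
    ∃ c : V → V, (∀ u ∈ U, c u ∈ D) ∧ ∀ u ∈ U, ∀ v ∈ U, G.Adj u v → c u ≠ c v := by
  have h4 := h.four_le
  obtain ⟨q, -⟩ : Q.Nonempty := Finset.card_pos.1 (by omega)
  have : Nonempty V := ⟨q⟩
  exact exists_coloring_of_transitive U
    (fun u hu v hv w hw => h.adj_trans_of_subset hS (hU u hu) (hU v hv) (hU w hw))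
    (fun _ x => x ∈ D)
    (fun K hK hKU _ => exists_injOn_of_card_le K (fun _ => D) fun _ _ => hD K hK hKU)

theorem colorable_of_bipartition [Fintype V] {A B E : Finset V} (hAB : Disjoint A B)
    (hQ : A ∪ B = Q) (hB2 : 2 ≤ B.card) (hE : E ⊆ B)
    (htri : ∀ u, (τ u).card + 2 ≤ Q.card → (τ u).Nonempty → τ u ⊆ A ∨ τ u ⊆ B ∨ B ⊆ τ u)
    (hR : ∀ u v, τ u = ∅ → τ v = ∅ → ¬ G.Adj u v)
    (hA : ∀ K : Finset V, G.IsClique (K : Set V) → (∀ u ∈ K, u ∈ traceSide G Q A) →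
      K.card ≤ (B \ E).card)
    (hB : ∃ c : V → V, (∀ u ∈ traceSide G Q B, c u ∈ A ∪ E ∧ c u ∉ τ u) ∧
      ∀ u ∈ traceSide G Q B, ∀ v ∈ traceSide G Q B, G.Adj u v → c u ≠ c v) :
    G.Colorable (Q.card + 1) := by
  have hcard : A.card + B.card = Q.card := by rw [← hQ, Finset.card_union_of_disjoint hAB]
  have hAQ : A ⊆ Q := hQ ▸ Finset.subset_union_left
  have hBQ : B ⊆ Q := hQ ▸ Finset.subset_union_right
  obtain ⟨cA, hcA, hcA'⟩ := h.exists_coloring_of_card_le (S := A) (D := B \ E) (by omega)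
    (fun u (hu : u ∈ traceSide G Q A) => hu.2) hA
  obtain ⟨cB, hcB, hcB'⟩ := hB
  have hT : ∀ T : Finset V, ∃ c : V → V, T ⊆ Q → T.card + 2 ≤ Q.card →
      (∀ u, τ u = T → c u ∈ Q \ T) ∧ ∀ u v, τ u = T → τ v = T → G.Adj u v → c u ≠ c v := by
    intro T
    by_cases hTc : T ⊆ Q ∧ T.card + 2 ≤ Q.card
    · obtain ⟨c, hc, hc'⟩ := h.exists_coloring_of_card_le (S := T) (D := Q \ T)
        (U := {u | τ u = T}) hTc.2 (fun u hu => (show τ u = T from hu).le) (by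
          intro K hK hKT
          have := h.card_add_card_le hTc.1 hK fun k hk => (show τ k = T from hKT k hk).ge
          have := Finset.le_card_sdiff T Q
          omega)
      exact ⟨c, fun _ _ => ⟨hc, fun u v hu hv => hc' u hu v hv⟩⟩
    · exact ⟨id, fun h1 h2 => (hTc ⟨h1, h2⟩).elim⟩
  choose cT hcT using hT
  let c : V → V ⊕ Fin 1 := fun u => if τ u = ∅ then .inr 0 else if τ u ⊆ A then .inl (cA u) else
    if τ u ⊆ B then .inl (cB u) else .inl (cT (τ u) u)
  have hc0 : ∀ u, τ u = ∅ → c u = .inr 0 := fun u hu => by simp only [c, hu, if_true]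
  have hc1 : ∀ u, u ∈ traceSide G Q A → c u = .inl (cA u) := fun u hu => by
    simp only [c, hu.1.ne_empty, hu.2, if_true, if_false]
  have hnot : ∀ u, u ∈ traceSide G Q B → ¬ τ u ⊆ A := by
    intro u hu huA
    obtain ⟨p, hp⟩ := hu.1
    exact Finset.disjoint_left.1 hAB (huA hp) (hu.2 hp)
  have hc2 : ∀ u, u ∈ traceSide G Q B → c u = .inl (cB u) := fun u hu => by
    simp only [c, hu.1.ne_empty, hu.2, hnot u hu, if_true, if_false]
  have hc3 : ∀ u, (τ u).Nonempty → ¬ τ u ⊆ A → ¬ τ u ⊆ B → c u = .inl (cT (τ u) u) :=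
    fun u hu hA hB => by simp only [c, hu.ne_empty, hA, hB, if_false]
  have hcases : ∀ u, τ u = ∅ ∨ u ∈ traceSide G Q A ∨ u ∈ traceSide G Q B ∨
      ((τ u).Nonempty ∧ ¬ τ u ⊆ A ∧ ¬ τ u ⊆ B) := by
    intro u
    rcases (τ u).eq_empty_or_nonempty with hu | hu
    · exact Or.inl hu
    · simp only [mem_traceSide]
      tauto
  have hval : ∀ u, (τ u).card + 2 ≤ Q.card → ∀ a, c u = .inl a → a ∈ Q ∧ a ∉ τ u := by
    intro u hu a ha
    rcases hcases u with hu0 | huA | huB | ⟨hu0, huA, huB⟩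
    · rw [hc0 u hu0] at ha
      exact (Sum.inr_ne_inl ha).elim
    · rw [hc1 u huA] at ha
      obtain rfl := Sum.inl_injective ha
      have := (Finset.mem_sdiff.1 (hcA u huA)).1
      exact ⟨hBQ this, fun hh => Finset.disjoint_left.1 hAB (huA.2 hh) this⟩
    · rw [hc2 u huB] at ha
      obtain rfl := Sum.inl_injective ha
      exact ⟨(Finset.union_subset hAQ (hE.trans hBQ)) (hcB u huB).1, (hcB u huB).2⟩
    · rw [hc3 u hu0 huA huB] at ha
      obtain rfl := Sum.inl_injective ha
      exact Finset.mem_sdiff.1 ((hcT _ (traceOn_subset u) hu).1 u rfl)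
  refine h.colorable_of_small_coloring c hval ?_ ?_
  · have hcov : ∀ u v, (τ u).card + 2 ≤ Q.card → (τ v).card + 2 ≤ Q.card → τ u ∪ τ v = Q →
        (τ u).Nonempty → c u ≠ c v := by
      intro u v hu hv huv hu0 he
      obtain ⟨a, ha⟩ : ∃ a, c u = .inl a := by
        rcases hcases u with hu0' | huA | huB | ⟨hu0, huA, huB⟩
        · exact (hu0.ne_empty hu0').elim
        · exact ⟨_, hc1 u huA⟩
        · exact ⟨_, hc2 u huB⟩
        · exact ⟨_, hc3 u hu0 huA huB⟩
      have h1 := hval u hu a ha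
      have h2 := hval v hv a (he ▸ ha)
      have h1' : a ∈ τ u ∪ τ v := by rw [huv]; exact h1.1
      exact (Finset.mem_union.1 h1').elim h1.2 h2.2
    have h0 : ∀ u v, τ u = ∅ → G.Adj u v → c u ≠ c v := by
      intro u v hu huv
      rw [hc0 u hu]
      rcases hcases v with hv0 | hvA | hvB | ⟨hv0, hvA, hvB⟩
      · exact (hR u v hu hv0 huv).elim
      · simp [hc1 v hvA]
      · simp [hc2 v hvB]
      · simp [hc3 v hv0 hvA hvB]
    have h12 : ∀ u v, u ∈ traceSide G Q A → v ∈ traceSide G Q B → c u ≠ c v := by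
      intro u v hu hv he
      rw [hc1 u hu, hc2 v hv] at he
      have h1 := Finset.mem_sdiff.1 (hcA u hu)
      have h2 := (hcB v hv).1
      rw [← Sum.inl_injective he, Finset.mem_union] at h2
      exact h2.elim (fun hh => Finset.disjoint_left.1 hAB hh h1.1) h1.2
    have hB3 : ∀ u, (τ u).card + 2 ≤ Q.card → (τ u).Nonempty → ¬ τ u ⊆ A → ¬ τ u ⊆ B →
        B ⊆ τ u := by
      intro u hu hu0 huA huB
      have := htri u hu hu0
      tauto
    have h3 : ∀ u v, (τ u).card + 2 ≤ Q.card → (τ v).card + 2 ≤ Q.card → (τ u).Nonempty →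
        ¬ τ u ⊆ A → ¬ τ u ⊆ B → (τ v).Nonempty → G.Adj u v → c u ≠ c v := by
      intro u v hu hv hu0 huA huB hv0 huv
      have hBu := hB3 u hu hu0 huA huB
      have hcu := Finset.mem_sdiff.1 ((hcT _ (traceOn_subset u) hu).1 u rfl)
      by_cases hd : Disjoint B (τ v)
      · have hvA : v ∈ traceSide G Q A := by
          refine ⟨hv0, fun p hp => ?_⟩
          have hpQ := mem_of_mem_traceOn hp
          rw [← hQ, Finset.mem_union] at hpQ
          exact hpQ.elim id fun hpB => (Finset.disjoint_left.1 hd hpB hp).elim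
        intro he
        rw [hc1 v hvA, hc3 u hu0 huA huB] at he
        have h1 := Finset.mem_sdiff.1 (hcA v hvA)
        rw [← Sum.inl_injective he] at h1
        exact hcu.2 (hBu h1.1)
      · obtain ⟨q, hqB, hqv⟩ := Finset.not_disjoint_iff.1 hd
        rcases h.eq_or_union_eq huv (hBu hqB) hqv with he | he
        · rw [hc3 u hu0 huA huB, hc3 v hv0 (he ▸ huA) (he ▸ huB), ← he]
          exact fun hh => (hcT _ (traceOn_subset u) hu).2 u v rfl he.symm huv
            (Sum.inl_injective hh)
        · exact hcov u v hu hv he hu0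
    intro u v hu hv huv
    rcases hcases u with hu0 | huA | huB | ⟨hu0, huA, huB⟩
    · exact h0 u v hu0 huv
    · rcases hcases v with hv0 | hvA | hvB | ⟨hv0, hvA, hvB⟩
      · exact (h0 v u hv0 huv.symm).symm
      · rw [hc1 u huA, hc1 v hvA]
        exact fun he => hcA' u huA v hvA huv (Sum.inl_injective he)
      · exact h12 u v huA hvB
      · exact (h3 v u hv hu hv0 hvA hvB huA.1 huv.symm).symm
    · rcases hcases v with hv0 | hvA | hvB | ⟨hv0, hvA, hvB⟩
      · exact (h0 v u hv0 huv.symm).symm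
      · exact (h12 v u hvA huB).symm
      · rw [hc2 u huB, hc2 v hvB]
        exact fun he => hcB' u huB v hvB huv (Sum.inl_injective he)
      · exact (h3 v u hv hu hv0 hvA hvB huB.1 huv.symm).symm
    · by_cases hv0 : (τ v).Nonempty
      · exact h3 u v hu hv hu0 huA huB hv0 huv
      · exact (h0 v u (Finset.not_nonempty_iff_eq_empty.1 hv0) huv.symm).symm
  · intro u w hu _ _ a ha
    rw [hc0 u hu] at ha
    exact (Sum.inr_ne_inl ha).elim

end CliqueSetting

/-- A splitting of the maximum clique `Q` into the parts `A` and `B`, where `A` is a largest trace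
missing at least two vertices of `Q`, and no edge is anticomplete to a maximum clique. -/
structure TraceSplit (G : SimpleGraph V) (Q A B : Finset V) : Prop extends CliqueSetting G Q where
  disj : Disjoint A B
  union_eq : A ∪ B = Q
  two_le_left : 2 ≤ A.card
  two_le_right : 2 ≤ B.card
  exists_eq : ∃ x, traceOn G Q x = A
  card_traceOn_le : ∀ u, (traceOn G Q u).card + 2 ≤ Q.card → (traceOn G Q u).card ≤ A.card
  exists_adj : ∀ L : Finset V, G.IsClique (L : Set V) → L.card = Q.card → ∀ u v, G.Adj u v →
    ∃ q ∈ L, G.Adj u q ∨ G.Adj v q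

namespace TraceSplit

variable {A B : Finset V} (s : TraceSplit G Q A B)
include s

theorem card_add_card : A.card + B.card = Q.card := by
  rw [← s.union_eq, Finset.card_union_of_disjoint s.disj]

theorem left_subset : A ⊆ Q := s.union_eq ▸ Finset.subset_union_left

theorem right_subset : B ⊆ Q := s.union_eq ▸ Finset.subset_union_right

theorem mem_or_mem {q : V} (hq : q ∈ Q) : q ∈ A ∨ q ∈ B := by
  rwa [← s.union_eq, Finset.mem_union] at hq

theorem notMem_right {q : V} (hq : q ∈ A) : q ∉ B := Finset.disjoint_left.1 s.disj hq

theorem notMem_left {q : V} (hq : q ∈ B) : q ∉ A := Finset.disjoint_right.1 s.disj hq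

theorem card_left_add_two : A.card + 2 ≤ Q.card := by
  have := s.card_add_card
  have := s.two_le_right
  omega

theorem card_right_add_two : B.card + 2 ≤ Q.card := by
  have := s.card_add_card
  have := s.two_le_left
  omega

theorem notMem_of_subset_left {u : V} (hu : τ u ⊆ A) : u ∉ Q :=
  s.notMem_of_small (by
    have := Finset.card_le_card hu
    have := s.card_left_add_two
    omega)

theorem notMem_of_subset_right {u : V} (hu : τ u ⊆ B) : u ∉ Q :=
  s.notMem_of_small (by
    have := Finset.card_le_card hu
    have := s.card_right_add_two
    omega)

theorem subset_trichotomy {u : V} (hu : (τ u).card + 2 ≤ Q.card) :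
    τ u ⊆ A ∨ τ u ⊆ B ∨ B ⊆ τ u := by
  obtain ⟨x, hx⟩ := s.exists_eq
  by_cases hd : Disjoint (τ u) A
  · refine Or.inr (Or.inl fun q hq => ?_)
    exact (s.mem_or_mem (mem_of_mem_traceOn hq)).resolve_left (Finset.disjoint_left.1 hd hq)
  obtain ⟨q, hqu, hqA⟩ := Finset.not_disjoint_iff.1 hd
  rw [← hx] at hqA
  by_cases hux : G.Adj u x
  · rcases s.eq_or_union_eq hux hqu hqA with he | he
    · exact Or.inl (he.trans hx).le
    · refine Or.inr (Or.inr fun b hb => ?_)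
      have hbQ := s.right_subset hb
      rw [← he, hx, Finset.mem_union] at hbQ
      exact hbQ.resolve_right (s.notMem_left hb)
  · rcases s.subset_or_subset hux hqu hqA with he | he
    · exact Or.inl (he.trans hx.le)
    · rw [hx] at he
      exact Or.inl (Finset.eq_of_subset_of_card_le he (s.card_traceOn_le u hu)).ge

theorem not_adj_of_eq_left {x w : V} (hx : τ x = A) (hw : (τ w).Nonempty) (hwA : τ w ⊆ A)
    (hne : τ w ≠ A) : ¬ G.Adj x w := by
  intro hxw
  obtain ⟨q, hq⟩ := hw
  rcases s.eq_or_disjoint_of_adj s.card_left_add_two hx.le hwA hxw with he | he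
  · exact hne (he.symm.trans hx)
  · rw [hx] at he
    exact Finset.disjoint_left.1 he (hwA hq) hq

theorem left_subset_union {w w' : V} (hw : w ∈ traceSide G Q A) (hw' : w' ∈ traceSide G Q A)
    (hne : τ w ≠ A) (hne' : τ w' ≠ A) (hadj : G.Adj w w') : A ⊆ τ w ∪ τ w' := by
  obtain ⟨x, hx⟩ := s.exists_eq
  intro p hp
  by_contra hpw
  rw [Finset.mem_union, not_or] at hpw
  obtain ⟨b, hb⟩ : B.Nonempty := Finset.card_pos.1 (by have := s.two_le_right; omega)
  have := s.mem_traceOn_of_anti hadj (s.not_adj_of_eq_left hx hw.1 hw.2 hne)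
    (s.not_adj_of_eq_left hx hw'.1 hw'.2 hne') (s.notMem_of_subset_left hx.le) (hx ▸ hp)
    hpw.1 hpw.2 (s.right_subset hb) (fun hh => s.notMem_left hb (hw.2 hh))
    (fun hh => s.notMem_left hb (hw'.2 hh))
  exact s.notMem_left hb (hx ▸ this)

theorem disjoint_of_adj_left {w w' : V} (hw : w ∈ traceSide G Q A) (hw' : w' ∈ traceSide G Q A)
    (hne : τ w ≠ A) (hne' : τ w' ≠ A) (hadj : G.Adj w w') : Disjoint (τ w) (τ w') := by
  rcases s.eq_or_disjoint_of_adj s.card_left_add_two hw.2 hw'.2 hadj with he | he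
  · have := s.left_subset_union hw hw' hne hne' hadj
    rw [← he, Finset.union_self] at this
    exact (hne (hw.2.antisymm this)).elim
  · exact he

theorem ne_left_of_adj {w w' : V} (hw : w ∈ traceSide G Q A) (hne : τ w ≠ A)
    (hadj : G.Adj w w') : τ w' ≠ A :=
  fun he => s.not_adj_of_eq_left he hw.1 hw.2 hne hadj.symm

theorem card_le_of_isClique_left {K : Finset V} (hK : G.IsClique (K : Set V))
    (hKA : ∀ u ∈ K, u ∈ traceSide G Q A) : K.card ≤ B.card := by
  have hsum := s.card_add_card
  by_cases hall : ∀ u ∈ K, τ u = A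
  · have := s.card_add_card_le s.left_subset hK fun u hu => (hall u hu).ge
    omega
  push Not at hall
  obtain ⟨w, hw, hne⟩ := hall
  have hne' : ∀ v ∈ K, τ v ≠ A := by
    intro v hv
    by_cases hwv : w = v
    · rwa [← hwv]
    · exact s.ne_left_of_adj (hKA w hw) hne (hK hw hv hwv)
  have := s.two_le_right
  by_contra! hc
  obtain ⟨a, b, c, ha, hb, hc, hab, hac, hbc⟩ := Finset.two_lt_card_iff.1 (by omega : 2 < K.card)
  have h1 := s.left_subset_union (hKA a ha) (hKA b hb) (hne' a ha) (hne' b hb) (hK ha hb hab)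
  have h2 := s.disjoint_of_adj_left (hKA a ha) (hKA c hc) (hne' a ha) (hne' c hc) (hK ha hc hac)
  have h3 := s.disjoint_of_adj_left (hKA b hb) (hKA c hc) (hne' b hb) (hne' c hc) (hK hb hc hbc)
  obtain ⟨q, hq⟩ := (hKA c hc).1
  rcases Finset.mem_union.1 (h1 ((hKA c hc).2 hq)) with hh | hh
  · exact Finset.disjoint_left.1 h2 hh hq
  · exact Finset.disjoint_left.1 h3 hh hq

section BigClique

variable {L : Finset V} (hL : G.IsClique (L : Set V)) (hLB : ∀ u ∈ L, u ∈ traceSide G Q B)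
  (hLA : A.card < L.card)
include hL hLB

theorem eq_or_disjoint_of_mem {u v : V} (hu : u ∈ L) (hv : v ∈ L) :
    τ u = τ v ∨ Disjoint (τ u) (τ v) := by
  by_cases huv : u = v
  · exact Or.inl (by rw [huv])
  · exact s.eq_or_disjoint_of_adj s.card_right_add_two (hLB u hu).2 (hLB v hv).2 (hL hu hv huv)

include hLA

theorem ne_right {u : V} (hu : u ∈ L) : τ u ≠ B := by
  intro huB
  have := s.card_add_card_le s.right_subset hL fun v hv => by
    obtain ⟨q, hq⟩ := (hLB v hv).1
    rcases s.eq_or_disjoint_of_mem hL hLB hu hv with he | he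
    · exact (huB.symm.trans he).le
    · exact (Finset.disjoint_left.1 he (huB ▸ (hLB v hv).2 hq) hq).elim
  have := s.card_add_card
  omega

omit hLA in
theorem card_lt : L.card + 1 ≤ Q.card := by
  have := s.card_le L hL
  by_contra hc
  obtain ⟨a, ha, a', ha', hne⟩ := Finset.one_lt_card.1 s.two_le_left
  have key : ∀ p ∈ A, ∀ q ∈ L, ¬ G.Adj p q := fun p hp q hq hpq =>
    s.notMem_right hp ((hLB q hq).2 (mem_traceOn.2 ⟨s.left_subset hp, hpq.symm⟩))
  obtain ⟨q, hq, hq'⟩ := s.exists_adj L hL (by omega) a a'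
    (s.adj_of_mem (s.left_subset ha) (s.left_subset ha') hne)
  exact hq'.elim (key a ha q hq) (key a' ha' q hq)

omit hLA in
theorem right_subset_union_of_not_adj {w u v : V} (hw : w ∈ traceSide G Q A) (hu : u ∈ L)
    (hv : v ∈ L) (huv : u ≠ v) (hwu : ¬ G.Adj w u) (hwv : ¬ G.Adj w v) :
    τ w = A ∧ τ u ∪ τ v = B := by
  obtain ⟨p, hp⟩ := hw.1
  have hnot : ∀ {y z : V}, y ∈ L → z ∈ A → z ∉ τ y := fun hy hz hzy =>
    s.notMem_right hz ((hLB _ hy).2 hzy)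
  have key : ∀ q ∈ Q, q ∉ τ u → q ∉ τ v → q ∈ τ w := fun q hq hqu hqv =>
    s.mem_traceOn_of_anti (hL hu hv huv) hwu hwv (s.notMem_of_subset_left hw.2) hp
      (hnot hu (hw.2 hp)) (hnot hv (hw.2 hp)) hq hqu hqv
  refine ⟨hw.2.antisymm fun q hq => key q (s.left_subset hq) (hnot hu hq) (hnot hv hq),
    (Finset.union_subset (hLB u hu).2 (hLB v hv).2).antisymm fun q hq => ?_⟩
  by_contra hqn
  rw [Finset.mem_union, not_or] at hqn
  exact s.notMem_left hq (hw.2 (key q (s.right_subset hq) hqn.1 hqn.2))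

theorem disjoint_of_union_eq {u v : V} (hu : u ∈ L) (hv : v ∈ L) (huv : τ u ∪ τ v = B) :
    Disjoint (τ u) (τ v) := by
  rcases s.eq_or_disjoint_of_mem hL hLB hu hv with he | he
  · rw [← he, Finset.union_self] at huv
    exact (s.ne_right hL hLB hLA hu huv).elim
  · exact he

omit hLA in
theorem eq_of_union_eq {u v w : V} (hu : u ∈ L) (hv : v ∈ L) (hw : w ∈ L)
    (huv : τ u ∪ τ v = B) : τ w = τ u ∨ τ w = τ v := by
  obtain ⟨q, hq⟩ := (hLB w hw).1
  have hqB := (hLB w hw).2 hq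
  rw [← huv, Finset.mem_union] at hqB
  rcases hqB with hh | hh
  · exact Or.inl ((s.eq_or_disjoint_of_mem hL hLB hw hu).resolve_right
      fun hd => Finset.disjoint_left.1 hd hq hh)
  · exact Or.inr ((s.eq_or_disjoint_of_mem hL hLB hw hv).resolve_right
      fun hd => Finset.disjoint_left.1 hd hq hh)

omit hL hLB in
theorem exists_two_others (u : V) : ∃ v ∈ L, ∃ w ∈ L, v ≠ u ∧ w ≠ u ∧ v ≠ w := by
  have := s.two_le_left
  have hc : 1 < (L.erase u).card := by
    have := Finset.pred_card_le_card_erase (s := L) (a := u)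
    omega
  obtain ⟨v, hv, w, hw, hvw⟩ := Finset.one_lt_card.1 hc
  rw [Finset.mem_erase] at hv hw
  exact ⟨v, hv.2, w, hw.2, hv.1, hw.1, hvw⟩

omit hL hLB in
theorem exists_third (u v : V) : ∃ w ∈ L, w ≠ u ∧ w ≠ v := by
  obtain ⟨a, ha, b, hb, hau, hbu, hab⟩ := s.exists_two_others hLA u
  by_cases hav : a = v
  · exact ⟨b, hb, hbu, fun hbv => hab (hav.trans hbv.symm)⟩
  · exact ⟨a, ha, hau, hav⟩

theorem adj_or_adj {y y' u : V} (hy : τ y = A) (hy' : τ y' = A) (hyy : G.Adj y y')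
    (hu : u ∈ L) : G.Adj y u ∨ G.Adj y' u := by
  by_contra hc
  rw [not_or] at hc
  obtain ⟨p, hp⟩ := (hLB u hu).1
  have hpA := s.notMem_left ((hLB u hu).2 hp)
  refine s.ne_right hL hLB hLA hu ((hLB u hu).2.antisymm fun q hq => ?_)
  have hqA := s.notMem_left hq
  exact s.mem_traceOn_of_anti hyy (fun hh => hc.1 hh.symm) (fun hh => hc.2 hh.symm)
    (s.notMem_of_subset_right (hLB u hu).2) hp (hy ▸ hpA) (hy' ▸ hpA) (s.right_subset hq)
    (hy ▸ hqA) (hy' ▸ hqA)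

theorem not_adj_of_not_adj_of_adj {y y' u v : V} (hy : τ y = A) (hy' : τ y' = A)
    (hyy : G.Adj y y') (hu : u ∈ L) (hv : v ∈ L) (huv : u ≠ v) (hyu : ¬ G.Adj y u)
    (hyv : G.Adj y v) : ¬ G.Adj y' v := by
  intro hyv'
  obtain ⟨a, ha⟩ : A.Nonempty := Finset.card_pos.1 (by have := s.two_le_left; omega)
  have hna : ∀ z ∈ L, ¬ G.Adj z a := fun z hz hza =>
    s.notMem_right ha ((hLB z hz).2 (mem_traceOn.2 ⟨s.left_subset ha, hza⟩))
  have hyu' := (s.adj_or_adj hL hLB hLA hy hy' hyy hu).resolve_left hyu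
  exact no_induced_gem s.gem_free (hL hu hv huv) hyv.symm
    (adj_of_mem_traceOn (hy.symm ▸ ha : a ∈ τ y)) (fun hh => hyu hh.symm) (hna u hu) (hna v hv)
    hyu' hyv' hyy.symm (adj_of_mem_traceOn (hy'.symm ▸ ha : a ∈ τ y'))

theorem not_two_missed {y y' u v : V} (hy : τ y = A) (hy' : τ y' = A) (hyy : G.Adj y y')
    (hu : u ∈ L) (hv : v ∈ L) (huv : u ≠ v) (hyu : ¬ G.Adj y u) (hyv : ¬ G.Adj y v) : False := by
  have hA : A.Nonempty := Finset.card_pos.1 (by have := s.two_le_left; omega)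
  have hyA : y ∈ traceSide G Q A := ⟨hy ▸ hA, hy.le⟩
  obtain ⟨w, hw, hwu, hwv⟩ := s.exists_third hLA u v
  have key : ∀ u v, u ∈ L → v ∈ L → u ≠ v → ¬ G.Adj y u → ¬ G.Adj y v → w ≠ u → w ≠ v →
      τ w = τ u → False := by
    intro u v hu hv huv hyu hyv hwu hwv he
    have hU := (s.right_subset_union_of_not_adj hL hLB hyA hu hv huv hyu hyv).2
    have hd := s.disjoint_of_union_eq hL hLB hLA hu hv hU
    have hyw : G.Adj y w := by
      by_contra hyw
      have := (s.right_subset_union_of_not_adj hL hLB hyA hu hw hwu.symm hyu hyw).2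
      rw [he, Finset.union_self] at this
      exact s.ne_right hL hLB hLA hu this
    have hyw' := s.not_adj_of_not_adj_of_adj hL hLB hLA hy hy' hyy hu hw hwu.symm hyu hyw
    obtain ⟨p, hp⟩ := (hLB u hu).1
    have hpB := (hLB u hu).2 hp
    refine no_induced_gem s.gem_free (a := y') (b := v) (c := w) (d := p) (x := u)
      ((s.adj_or_adj hL hLB hLA hy hy' hyy hv).resolve_left hyv) (hL hv hw hwv.symm)
      (adj_of_mem_traceOn (he ▸ hp)) hyw' ?_ ?_
      ((s.adj_or_adj hL hLB hLA hy hy' hyy hu).resolve_left hyu).symm (hL hu hv huv)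
      (hL hu hw hwu.symm) (adj_of_mem_traceOn hp)
    · exact not_adj_of_notMem_traceOn (s.right_subset hpB) (hy' ▸ s.notMem_left hpB)
    · exact not_adj_of_notMem_traceOn (s.right_subset hpB) (Finset.disjoint_left.1 hd hp)
  have hU := (s.right_subset_union_of_not_adj hL hLB hyA hu hv huv hyu hyv).2
  rcases s.eq_of_union_eq hL hLB hu hv hw hU with he | he
  · exact key u v hu hv huv hyu hyv hwu hwv he
  · exact key v u hv hu huv.symm hyv hyu hwv hwu he

theorem adj_of_eq_left {y y' u : V} (hy : τ y = A) (hy' : τ y' = A) (hyy : G.Adj y y')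
    (hu : u ∈ L) : G.Adj y u := by
  by_contra hyu
  obtain ⟨v, hv, w, hw, hvu, hwu, hvw⟩ := s.exists_two_others hLA u
  have key : ∀ z ∈ L, z ≠ u → ¬ G.Adj y' z := fun z hz hzu =>
    s.not_adj_of_not_adj_of_adj hL hLB hLA hy hy' hyy hu hz hzu.symm hyu (by
      by_contra hyz
      exact s.not_two_missed hL hLB hLA hy hy' hyy hu hz hzu.symm hyu hyz)
  exact s.not_two_missed hL hLB hLA hy' hy hyy.symm hv hw hvw (key v hv hvu) (key w hw hwu)

omit hLA in
theorem union_eq_of_not_adj {w u v : V} (hw : w ∈ traceSide G Q A) (hne : τ w ≠ A)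
    (hu : u ∈ L) (hwu : ¬ G.Adj w u) (hv : v ∈ L) (hvu : v ≠ u) :
    G.Adj w v ∧ τ u ∪ τ v = B := by
  have hwv : G.Adj w v := by
    by_contra hwv
    exact hne (s.right_subset_union_of_not_adj hL hLB hw hu hv hvu.symm hwu hwv).1
  refine ⟨hwv, Finset.eq_of_subset_of_card_le
    (Finset.union_subset (hLB u hu).2 (hLB v hv).2) ?_⟩
  by_contra hc
  have hlt := Finset.card_lt_card (hw.2.ssubset_of_ne hne)
  have hwu' : w ≠ u := by
    rintro rfl
    obtain ⟨q, hq⟩ := hw.1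
    exact s.notMem_right (hw.2 hq) ((hLB w hu).2 hq)
  refine hwu (s.adj_trans_of_subset (S := τ w ∪ (τ u ∪ τ v)) ?_ Finset.subset_union_left
    (Finset.subset_union_right.trans Finset.subset_union_right)
    (Finset.subset_union_left.trans Finset.subset_union_right) hwv (hL hv hu hvu) hwu')
  have := Finset.card_union_le (τ w) (τ u ∪ τ v)
  have := s.card_add_card
  omega

theorem adj_of_ne_left {w w' u : V} (hw : w ∈ traceSide G Q A) (hw' : w' ∈ traceSide G Q A)
    (hne : τ w ≠ A) (hww : G.Adj w w') (hu : u ∈ L) : G.Adj w u := by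
  by_contra hwu
  have hne' := s.ne_left_of_adj hw hne hww
  obtain ⟨x, hx⟩ := s.exists_eq
  have hxw := s.not_adj_of_eq_left hx hw.1 hw.2 hne
  have hxw' := s.not_adj_of_eq_left hx hw'.1 hw'.2 hne'
  have hxQ : x ∉ Q := s.notMem_of_subset_left hx.le
  obtain ⟨v, hv, z, hz, hvu, hzu, hvz⟩ := s.exists_two_others hLA u
  have hnotA : ∀ {y q : V}, y ∈ L → q ∈ τ y → q ∉ A := fun hy hq => s.notMem_left ((hLB _ hy).2 hq)
  have hnotB : ∀ {y q : V}, y ∈ L → q ∈ A → q ∉ τ y := fun hy hq hqy => hnotA hy hqy hq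
  obtain ⟨hwv, hUv⟩ := s.union_eq_of_not_adj hL hLB hw hne hu hwu hv hvu
  obtain ⟨hwz, hUz⟩ := s.union_eq_of_not_adj hL hLB hw hne hu hwu hz hzu
  have hdv := s.disjoint_of_union_eq hL hLB hLA hu hv hUv
  have hdz := s.disjoint_of_union_eq hL hLB hLA hu hz hUz
  obtain ⟨p, hp⟩ := (hLB u hu).1
  obtain ⟨q, hq⟩ := (hLB v hv).1
  have hqu : q ∉ τ u := Finset.disjoint_right.1 hdv hq
  have hqQ := mem_of_mem_traceOn hq
  have hwu' : G.Adj w' u := by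
    by_contra hwu'
    exact hqu (s.mem_traceOn_of_anti hww (fun hh => hwu hh.symm) (fun hh => hwu' hh.symm)
      (s.notMem_of_subset_right (hLB u hu).2) hp (fun hh => hnotA hu hp (hw.2 hh))
      (fun hh => hnotA hu hp (hw'.2 hh)) hqQ (fun hh => hnotA hv hq (hw.2 hh))
      (fun hh => hnotA hv hq (hw'.2 hh)))
  have hxu : G.Adj x u := by
    by_contra hxu
    obtain ⟨a, ha⟩ := hw.1
    have haA := hw.2 ha
    have := s.mem_traceOn_of_anti hwu'.symm hxu hxw' hxQ (hx.symm ▸ haA) (hnotB hu haA)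
      (Finset.disjoint_left.1 (s.disjoint_of_adj_left hw hw' hne hne' hww) ha) hqQ hqu
      (fun hh => hnotA hv hq (hw'.2 hh))
    exact hnotA hv hq (hx ▸ this)
  obtain ⟨y, hy, hyu, hwy, hxy⟩ : ∃ y ∈ L, y ≠ u ∧ G.Adj w y ∧ G.Adj x y := by
    by_contra! hc
    have hxA : x ∈ traceSide G Q A := ⟨hx.symm ▸ hw.1.mono hw.2, hx.le⟩
    have := (s.right_subset_union_of_not_adj hL hLB hxA hv hz hvz (hc v hv hvu hwv)
      (hc z hz hzu hwz)).2
    have hpB := (hLB u hu).2 hp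
    rw [← this, Finset.mem_union] at hpB
    exact hpB.elim (Finset.disjoint_left.1 hdv hp) (Finset.disjoint_left.1 hdz hp)
  have hwy' : G.Adj w' y := by
    by_contra hwy'
    obtain ⟨t, ht, htu, hty⟩ := s.exists_third hLA u y
    have hUt := (s.union_eq_of_not_adj hL hLB hw hne hu hwu ht htu).2
    have hUy := (s.union_eq_of_not_adj hL hLB hw' hne' hy hwy' ht hty).2
    have hdt := s.disjoint_of_union_eq hL hLB hLA hu ht hUt
    have hdy := s.disjoint_of_union_eq hL hLB hLA hy ht hUy
    have hUuy := (s.union_eq_of_not_adj hL hLB hw hne hu hwu hy hyu).2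
    obtain ⟨r, hr⟩ := (hLB t ht).1
    have hrB := (hLB t ht).2 hr
    rw [← hUuy, Finset.mem_union] at hrB
    exact hrB.elim (Finset.disjoint_right.1 hdt hr) (Finset.disjoint_right.1 hdy hr)
  exact no_induced_gem s.gem_free hxu hwu'.symm hww.symm hxw' hxw (fun hh => hwu hh.symm)
    hxy.symm (hL hy hu hyu) hwy'.symm hwy.symm

theorem card_add_card_le_of_isClique {K : Finset V} (hK : G.IsClique (K : Set V))
    (hKA : ∀ u ∈ K, u ∈ traceSide G Q A) : K.card + L.card ≤ Q.card := by
  by_cases hK1 : K.card ≤ 1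
  · have := s.card_lt hL hLB
    omega
  have hadj : ∀ k ∈ K, ∀ u ∈ L, G.Adj k u := by
    intro k hk u hu
    obtain ⟨k', hk', hne⟩ := Finset.exists_mem_ne (by omega : 1 < K.card) k
    have hkk := hK hk hk' hne.symm
    by_cases he : τ k = A
    · have he' : τ k' = A := by
        by_contra he'
        exact s.ne_left_of_adj (hKA k' hk') he' hkk.symm he
      exact s.adj_of_eq_left hL hLB hLA he he' hkk hu
    · exact s.adj_of_ne_left hL hLB hLA (hKA k hk) (hKA k' hk') he hkk hu
  have hd : Disjoint K L := by
    rw [Finset.disjoint_left]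
    intro k hk hkL
    exact G.irrefl (hadj k hk k hkL)
  rw [← Finset.card_union_of_disjoint hd]
  refine s.card_le _ fun x hx y hy hxy => ?_
  simp only [Finset.coe_union, Set.mem_union, Finset.mem_coe] at hx hy
  rcases hx with hx | hx <;> rcases hy with hy | hy
  · exact hK hx hy hxy
  · exact hadj x hx y hy
  · exact (hadj y hy x hx).symm
  · exact hL hx hy hxy

end BigClique

end TraceSplit

namespace CliqueSetting

variable (h : CliqueSetting G Q)
include h

theorem subset_union_of_anticomplete {S : Finset V} (hS : S.card + 1 ≤ Q.card) {u v w : V}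
    (hw : τ w ⊆ S) (hu : τ u ⊆ S) (hv : τ v ⊆ S) (hwQ : w ∉ Q) (huv : G.Adj u v)
    (hwu : ¬ G.Adj w u) (hwv : ¬ G.Adj w v) : τ w ⊆ τ u ∪ τ v := by
  obtain ⟨q, hq, hqS⟩ := Finset.exists_mem_notMem_of_card_lt_card (by omega : S.card < Q.card)
  intro p hp
  by_contra hpn
  rw [Finset.mem_union, not_or] at hpn
  exact hqS (hw (h.mem_traceOn_of_anti huv hwu hwv hwQ hp hpn.1 hpn.2 hq (fun hh => hqS (hu hh))
    fun hh => hqS (hv hh)))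

/-- Two anticomplete cliques of size at least three whose traces lie in a common set missing at
least two vertices of `Q` have equal traces. -/
theorem traceOn_eq_of_anticomplete {S : Finset V} (hS : S.card + 2 ≤ Q.card) {K L : Finset V}
    (hK : G.IsClique (K : Set V)) (hL : G.IsClique (L : Set V))
    (hKS : ∀ u ∈ K, u ∈ traceSide G Q S) (hLS : ∀ u ∈ L, u ∈ traceSide G Q S)
    (hK3 : 3 ≤ K.card) (hL3 : 3 ≤ L.card) (hKL : ∀ u ∈ K, ∀ v ∈ L, ¬ G.Adj u v) :
    ∀ u ∈ K, ∀ v ∈ L, τ u = τ v := by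
  have hQ : ∀ {u}, u ∈ traceSide G Q S → u ∉ Q := fun hu => h.notMem_of_small (by
    have := Finset.card_le_card hu.2
    omega)
  have hmono : ∀ {K L : Finset V}, G.IsClique (K : Set V) → G.IsClique (L : Set V) →
      (∀ u ∈ K, u ∈ traceSide G Q S) → (∀ u ∈ L, u ∈ traceSide G Q S) → 3 ≤ K.card →
      3 ≤ L.card → (∀ u ∈ K, ∀ v ∈ L, ¬ G.Adj u v) → ∀ u ∈ L, ∀ v ∈ L, τ u = τ v := by
    intro K L hK hL hKS hLS hK3 hL3 hKL u hu v hv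
    have hed : ∀ {M : Finset V}, G.IsClique (M : Set V) → (∀ u ∈ M, u ∈ traceSide G Q S) →
        ∀ a ∈ M, ∀ b ∈ M, τ a = τ b ∨ Disjoint (τ a) (τ b) := by
      intro M hM hMS a ha b hb
      by_cases hab : a = b
      · exact Or.inl (by rw [hab])
      · exact h.eq_or_disjoint_of_adj hS (hMS a ha).2 (hMS b hb).2 (hM ha hb hab)
    have hsub : ∀ w ∈ K, ∀ a ∈ L, ∀ b ∈ L, a ≠ b → τ w ⊆ τ a ∪ τ b := fun w hw a ha b hb hab =>
      h.subset_union_of_anticomplete (by omega) (hKS w hw).2 (hLS a ha).2 (hLS b hb).2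
        (hQ (hKS w hw)) (hL ha hb hab) (hKL w hw a ha) (hKL w hw b hb)
    have hsub' : ∀ w ∈ L, ∀ a ∈ K, ∀ b ∈ K, a ≠ b → τ w ⊆ τ a ∪ τ b := fun w hw a ha b hb hab =>
      h.subset_union_of_anticomplete (by omega) (hLS w hw).2 (hKS a ha).2 (hKS b hb).2
        (hQ (hLS w hw)) (hK ha hb hab) (fun hh => hKL a ha w hw hh.symm)
        fun hh => hKL b hb w hw hh.symm
    have key : ∀ a ∈ L, ∀ b ∈ L, ∀ c ∈ L, c ≠ a → τ c = τ a → Disjoint (τ a) (τ b) → False := by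
      intro a ha b hb c hc hca he hd
      obtain ⟨w, hw, w', hw', hne⟩ := Finset.one_lt_card.1 (by omega : 1 < K.card)
      have h1 := hsub w hw c hc a ha hca
      have h2 := hsub w' hw' c hc a ha hca
      rw [he, Finset.union_self] at h1 h2
      obtain ⟨p, hp⟩ := (hLS b hb).1
      exact Finset.disjoint_right.1 hd hp
        (Finset.union_subset h1 h2 (hsub' b hb w hw w' hw' hne hp))
    refine (hed hL hLS u hu v hv).resolve_right fun hd => ?_
    have huv : u ≠ v := by
      rintro rfl
      obtain ⟨p, hp⟩ := (hLS u hu).1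
      exact Finset.disjoint_left.1 hd hp hp
    obtain ⟨z, hz, hzn⟩ := Finset.exists_mem_notMem_of_card_lt_card
      (lt_of_le_of_lt Finset.card_le_two hL3 : ({u, v} : Finset V).card < L.card)
    simp only [Finset.mem_insert, Finset.mem_singleton, not_or] at hzn
    rcases hed hL hLS z hz u hu with h1 | h1
    · exact key u hu v hv z hz hzn.1 h1 hd
    rcases hed hL hLS z hz v hv with h2 | h2
    · exact key v hv u hu z hz hzn.2 h2 hd.symm
    obtain ⟨w, hw⟩ : K.Nonempty := Finset.card_pos.1 (by omega)
    obtain ⟨p, hp⟩ := (hKS w hw).1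
    rcases Finset.mem_union.1 (hsub w hw u hu v hv huv hp) with hpu | hpv
    · rcases Finset.mem_union.1 (hsub w hw z hz v hv hzn.2 hp) with hpz | hpv
      · exact Finset.disjoint_left.1 h1 hpz hpu
      · exact Finset.disjoint_left.1 hd hpu hpv
    · rcases Finset.mem_union.1 (hsub w hw z hz u hu hzn.1 hp) with hpz | hpu
      · exact Finset.disjoint_left.1 h2 hpz hpv
      · exact Finset.disjoint_left.1 hd hpu hpv
  intro u hu v hv
  obtain ⟨u', hu', huu⟩ := Finset.exists_mem_ne (by omega : 1 < K.card) u
  obtain ⟨v', hv', hvv⟩ := Finset.exists_mem_ne (by omega : 1 < L.card) v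
  have hLK : ∀ v ∈ L, ∀ u ∈ K, ¬ G.Adj v u := fun v hv u hu hh => hKL u hu v hv hh.symm
  have h1 := h.subset_union_of_anticomplete (by omega) (hKS u hu).2 (hLS v' hv').2 (hLS v hv).2
    (hQ (hKS u hu)) (hL hv' hv hvv) (hKL u hu v' hv') (hKL u hu v hv)
  have h2 := h.subset_union_of_anticomplete (by omega) (hLS v hv).2 (hKS u' hu').2 (hKS u hu).2
    (hQ (hLS v hv)) (hK hu' hu huu) (hLK v hv u' hu') (hLK v hv u hu)
  rw [hmono hK hL hKS hLS hK3 hL3 hKL v' hv' v hv, Finset.union_self] at h1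
  rw [hmono hL hK hLS hKS hL3 hK3 hLK u' hu' u hu, Finset.union_self] at h2
  exact h1.antisymm h2

end CliqueSetting

namespace TraceSplit

variable {A B : Finset V} (s : TraceSplit G Q A B)
include s

/-- The coloring of the vertices with trace in `B`, extending a coloring of a largest clique. -/
theorem exists_coloring_right [Fintype V] {L M : Finset V} (hL : G.IsClique (L : Set V))
    (hLB : ∀ u ∈ L, u ∈ traceSide G Q B) (hLA : A.card < L.card)
    (hmax : ∀ K : Finset V, G.IsClique (K : Set V) → (∀ u ∈ K, u ∈ traceSide G Q B) →
      K.card ≤ L.card) (hML : M ⊆ L) (hM : A.card + M.card = L.card) {f : V → V}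
    (hf : Set.InjOn f (M : Set V)) (hfB : ∀ u ∈ M, f u ∈ B ∧ f u ∉ τ u) :
    ∃ c : V → V, (∀ u ∈ traceSide G Q B, c u ∈ A ∪ M.image f ∧ c u ∉ τ u) ∧
      ∀ u ∈ traceSide G Q B, ∀ v ∈ traceSide G Q B, G.Adj u v → c u ≠ c v := by
  have htwo := s.two_le_left
  obtain ⟨a₀, ha₀⟩ : A.Nonempty := Finset.card_pos.1 (by omega)
  have : Nonempty V := ⟨a₀⟩
  have hA : ∀ {u y : V}, u ∈ traceSide G Q B → y ∈ A → y ∉ τ u := fun hu hy hyu =>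
    s.notMem_right hy (hu.2 hyu)
  obtain ⟨g, hg, hgA⟩ := exists_injOn_of_card_le (L \ M) (fun _ => A) fun _ _ => by
    rw [Finset.card_sdiff_of_subset hML]
    omega
  let c₀ : V → V := fun u => if u ∈ M then f u else g u
  have hc₀M : ∀ {u}, u ∈ M → c₀ u = f u := fun hu => if_pos hu
  have hc₀N : ∀ {u}, u ∉ M → c₀ u = g u := fun hu => if_neg hu
  have hgA' : ∀ {u}, u ∈ L → u ∉ M → g u ∈ A := fun hu hu' =>
    hgA _ (Finset.mem_sdiff.2 ⟨hu, hu'⟩)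
  have hc₀ : ∀ u ∈ L, c₀ u ∈ A ∪ M.image f ∧ c₀ u ∉ τ u := by
    intro u hu
    by_cases huM : u ∈ M
    · rw [hc₀M huM]
      exact ⟨Finset.mem_union_right _ (Finset.mem_image_of_mem f huM), (hfB u huM).2⟩
    · rw [hc₀N huM]
      exact ⟨Finset.mem_union_left _ (hgA' hu huM), hA (hLB u hu) (hgA' hu huM)⟩
  have hinj : Set.InjOn c₀ (L : Set V) := by
    intro u hu v hv he
    by_cases huM : u ∈ M <;> by_cases hvM : v ∈ M
    · rw [hc₀M huM, hc₀M hvM] at he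
      exact hf huM hvM he
    · rw [hc₀M huM, hc₀N hvM] at he
      exact (s.notMem_left (hfB u huM).1 (he ▸ hgA' hv hvM)).elim
    · rw [hc₀N huM, hc₀M hvM] at he
      exact (s.notMem_left (hfB v hvM).1 (he ▸ hgA' hu huM)).elim
    · rw [hc₀N huM, hc₀N hvM] at he
      exact hg (Finset.mem_coe.2 (Finset.mem_sdiff.2 ⟨hu, huM⟩))
        (Finset.mem_coe.2 (Finset.mem_sdiff.2 ⟨hv, hvM⟩)) he
  have hcard : (A ∪ M.image f).card = L.card := by
    rw [Finset.card_union_of_disjoint, Finset.card_image_of_injOn hf, hM]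
    rw [Finset.disjoint_left]
    intro y hy hyM
    obtain ⟨u, hu, rfl⟩ := Finset.mem_image.1 hyM
    exact s.notMem_left (hfB u hu).1 hy
  have htr : ∀ u ∈ traceSide G Q B, ∀ v ∈ traceSide G Q B, ∀ w ∈ traceSide G Q B, G.Adj u v →
      G.Adj v w → u ≠ w → G.Adj u w := fun u hu v hv w hw =>
    s.adj_trans_of_subset s.card_right_add_two hu.2 hv.2 hw.2
  have habs : ∀ u ∈ traceSide G Q B, ∀ v ∈ L, G.Adj u v → u ∈ L := by
    intro u hu v hv huv
    by_contra huL
    have := hmax (insert u L) (by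
      rw [Finset.coe_insert]
      refine hL.insert fun w hw huw => ?_
      by_cases hvw : v = w
      · rwa [← hvw]
      · exact htr u hu v (hLB v hv) w (hLB w hw) huv (hL hv hw hvw) huw) (by
      simpa only [Finset.forall_mem_insert] using ⟨hu, hLB⟩)
    rw [Finset.card_insert_of_notMem huL] at this
    omega
  obtain ⟨c, hc, hcp⟩ := exists_coloring_of_transitive (traceSide G Q B) htr
    (fun u y => (y ∈ A ∪ M.image f ∧ y ∉ τ u) ∧ (u ∈ L → y = c₀ u)) (by
      intro K hK hKB _
      by_cases hKL : ∃ v ∈ K, v ∈ L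
      · obtain ⟨v, hvK, hvL⟩ := hKL
        have hsub : K ⊆ L := by
          intro u hu
          by_cases huv : u = v
          · rwa [huv]
          · exact habs u (hKB u hu) v hvL (hK hu hvK huv)
        exact ⟨c₀, hinj.mono (by exact_mod_cast hsub),
          fun u hu => ⟨hc₀ u (hsub hu), fun _ => rfl⟩⟩
      push Not at hKL
      by_cases hKA : K.card ≤ A.card
      · obtain ⟨e, he, heA⟩ := exists_injOn_of_card_le K (fun _ => A) fun _ _ => hKA
        exact ⟨e, he, fun u hu => ⟨⟨Finset.mem_union_left _ (heA u hu),
          hA (hKB u hu) (heA u hu)⟩, fun huL => (hKL u hu huL).elim⟩⟩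
      have heq := s.traceOn_eq_of_anticomplete s.card_right_add_two hK hL hKB hLB (by omega)
        (by omega) fun u hu v hv huv => hKL u hu (habs u (hKB u hu) v hv huv)
      obtain ⟨e, he, heA⟩ := exists_injOn_of_card_le K (fun _ => A ∪ M.image f) fun _ _ => by
        rw [hcard]
        exact hmax K hK hKB
      refine ⟨e, he, fun u hu => ⟨⟨heA u hu, ?_⟩, fun huL => (hKL u hu huL).elim⟩⟩
      rcases Finset.mem_union.1 (heA u hu) with hh | hh
      · exact hA (hKB u hu) hh
      · obtain ⟨v, hv, hvu⟩ := Finset.mem_image.1 hh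
        rw [← hvu, heq u hu v (hML hv)]
        exact (hfB v hv).2)
  exact ⟨c, fun u hu => (hc u hu).1, hcp⟩

theorem colorable [Fintype V] : G.Colorable (Q.card + 1) := by
  have hsum := s.card_add_card
  have hR : ∀ u v, τ u = ∅ → τ v = ∅ → ¬ G.Adj u v := by
    intro u v hu hv huv
    obtain ⟨q, hq, hq'⟩ := s.exists_adj Q s.isClique rfl u v huv
    rcases hq' with hh | hh
    · have : q ∈ τ u := mem_traceOn.2 ⟨hq, hh⟩
      simp [hu] at this
    · have : q ∈ τ v := mem_traceOn.2 ⟨hq, hh⟩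
      simp [hv] at this
  have htri := fun u hu (_ : (τ u).Nonempty) => s.subset_trichotomy (u := u) hu
  by_cases hbig : ∀ K : Finset V, G.IsClique (K : Set V) → (∀ u ∈ K, u ∈ traceSide G Q B) →
      K.card ≤ A.card
  · obtain ⟨c, hc, hcp⟩ := s.exists_coloring_of_card_le s.card_right_add_two
      (U := traceSide G Q B) (fun u hu => hu.2) hbig
    refine s.colorable_of_bipartition (E := ∅) s.disj s.union_eq s.two_le_right (by simp) htri hR
      ?_ ⟨c, fun u hu => ⟨Finset.mem_union_left _ (hc u hu), fun hh =>
        s.notMem_right (hc u hu) (hu.2 hh)⟩, hcp⟩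
    intro K hK hKA
    rw [Finset.sdiff_empty]
    exact s.card_le_of_isClique_left hK hKA
  push Not at hbig
  obtain ⟨L₀, hL₀, hL₀B, hL₀A⟩ := hbig
  obtain ⟨L, hLmem, hmax⟩ := Finset.exists_max_image (Finset.univ.filter fun K : Finset V =>
    G.IsClique (K : Set V) ∧ ∀ u ∈ K, u ∈ traceSide G Q B) Finset.card
    ⟨L₀, by simpa using ⟨hL₀, hL₀B⟩⟩
  simp only [Finset.mem_filter, Finset.mem_univ, true_and] at hLmem hmax
  obtain ⟨hL, hLB⟩ := hLmem
  have hLA := hL₀A.trans_le (hmax L₀ ⟨hL₀, hL₀B⟩)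
  obtain ⟨f, hf, hfQ⟩ := s.exists_injOn_of_eq_or_disjoint hL
    (fun u hu v hv _ _ => s.eq_or_disjoint_of_mem hL hLB hu hv)
    fun v hv hv0 => ((hLB v hv).1.ne_empty hv0).elim
  have hN : L.card - A.card ≤ (L.filter fun u => f u ∈ B).card := by
    have h1 := Finset.card_filter_add_card_filter_not (s := L) (fun u => f u ∈ B)
    have h2 : (L.filter fun u => ¬ f u ∈ B).card ≤ A.card := by
      refine Finset.card_le_card_of_injOn f (fun u hu => ?_) (hf.mono fun u hu =>
        Finset.mem_coe.2 (Finset.mem_filter.1 (Finset.mem_coe.1 hu)).1)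
      rw [Finset.mem_coe, Finset.mem_filter] at hu
      exact (s.mem_or_mem (Finset.mem_sdiff.1 (hfQ u hu.1)).1).resolve_right hu.2
    omega
  obtain ⟨M, hMN, hM⟩ := Finset.exists_subset_card_eq hN
  have hML : M ⊆ L := hMN.trans (Finset.filter_subset _ _)
  have hfM : Set.InjOn f (M : Set V) := hf.mono (by exact_mod_cast hML)
  have hfB : ∀ u ∈ M, f u ∈ B ∧ f u ∉ τ u := fun u hu =>
    ⟨(Finset.mem_filter.1 (hMN hu)).2, fun hh => (Finset.mem_sdiff.1 (hfQ u (hML hu))).2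
      (traceOn_subset_forbiddenColors u hh)⟩
  have hE : M.image f ⊆ B := by
    intro y hy
    obtain ⟨u, hu, rfl⟩ := Finset.mem_image.1 hy
    exact (hfB u hu).1
  refine s.colorable_of_bipartition s.disj s.union_eq s.two_le_right hE htri hR ?_
    (s.exists_coloring_right hL hLB hLA (fun K hK hKB => hmax K ⟨hK, hKB⟩) hML (by omega) hfM hfB)
  intro K hK hKA
  rw [Finset.card_sdiff_of_subset hE, Finset.card_image_of_injOn hfM]
  have := s.card_add_card_le_of_isClique hL hLB hLA hK hKA
  omega

end TraceSplit

namespace CliqueSetting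

variable (h : CliqueSetting G Q)
include h

theorem card_add_one_le_of_traceOn_subset
    (hedge : ∀ L : Finset V, G.IsClique (L : Set V) → L.card = Q.card → ∀ u v, G.Adj u v →
      ∃ q ∈ L, G.Adj u q ∨ G.Adj v q)
    {S : Finset V} (hS : S.card + 2 ≤ Q.card) {M : Finset V} (hM : G.IsClique (M : Set V))
    (hMS : ∀ u ∈ M, τ u ⊆ S) : M.card + 1 ≤ Q.card := by
  have := h.card_le M hM
  by_contra hc
  have hc : 1 < (Q \ S).card := by
    have := Finset.le_card_sdiff S Q
    omega
  obtain ⟨a, ha, b, hb, hab⟩ := Finset.one_lt_card.1 hc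
  rw [Finset.mem_sdiff] at ha hb
  obtain ⟨q, hq, hq'⟩ := hedge M hM (by omega) a b (h.adj_of_mem ha.1 hb.1 hab)
  exact hq'.elim (fun hh => ha.2 (hMS q hq (mem_traceOn.2 ⟨ha.1, hh.symm⟩)))
    fun hh => hb.2 (hMS q hq (mem_traceOn.2 ⟨hb.1, hh.symm⟩))

theorem adj_trans_of_singleton {i j : V} {u v w : V} (hu : τ u ⊆ {i, j}) (hv : τ v ⊆ {i, j})
    (hw : τ w ⊆ {i, j}) (huv : G.Adj u v) (hvw : G.Adj v w) (huw : u ≠ w) : G.Adj u w :=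
  h.adj_trans_of_subset (S := {i, j}) (by
    have := h.four_le
    have := Finset.card_le_two (a := i) (b := j)
    omega) hu hv hw huv hvw huw

theorem adj_of_edge {a b v i j : V} (hab : G.Adj a b) (ha : τ a = {i}) (hb : τ b = {i})
    (hv : τ v = {j}) (hij : j ≠ i) : G.Adj v a := by
  have h4 := h.four_le
  have hsub : ∀ {u}, τ u = {i} → τ u ⊆ {i, j} := fun hu => by simp [hu]
  have hvsub : τ v ⊆ {i, j} := by simp [hv]
  have hne : ∀ {u}, τ u = {i} → v ≠ u := by
    rintro u hu rfl
    exact hij (Finset.singleton_injective (hv.symm.trans hu))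
  by_contra hva
  have hvb : ¬ G.Adj v b := fun hvb =>
    hva (h.adj_trans_of_singleton hvsub (hsub hb) (hsub ha) hvb hab.symm (hne ha))
  obtain ⟨q, hq, hqn⟩ := Finset.exists_mem_notMem_of_card_lt_card
    (lt_of_le_of_lt Finset.card_le_two (by omega : 2 < Q.card) : ({i, j} : Finset V).card < Q.card)
  simp only [Finset.mem_insert, Finset.mem_singleton, not_or] at hqn
  have := h.mem_traceOn_of_anti hab hva hvb (h.notMem_of_small (by
      rw [hv, Finset.card_singleton]
      omega)) (p := j) (by simp [hv]) (by simpa [ha] using hij) (by simpa [hb] using hij) hq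
    (by simpa [ha] using hqn.1) (by simpa [hb] using hqn.1)
  rw [hv, Finset.mem_singleton] at this
  exact hqn.2 this

theorem colorable_of_singleton_stable [Fintype V] (hcard : Q.card = 4)
    (hsize : ∀ u, (τ u).card + 2 ≤ Q.card → (τ u).card ≤ 1)
    (hR : ∀ u v, τ u = ∅ → τ v = ∅ → ¬ G.Adj u v)
    (hst : ∀ u v q, τ u = {q} → τ v = {q} → ¬ G.Adj u v) : G.Colorable (Q.card + 1) := by
  obtain ⟨A, hAQ, hA⟩ := Finset.exists_subset_card_eq (by omega : 2 ≤ Q.card)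
  have hB : (Q \ A).card = 2 := by rw [Finset.card_sdiff_of_subset hAQ]; omega
  have hside : ∀ S : Finset V, S.card = 2 → ∀ K : Finset V, G.IsClique (K : Set V) →
      (∀ u ∈ K, u ∈ traceSide G Q S) → K.card ≤ 2 := by
    intro S hS K hK hKS
    have h1 : ∀ u ∈ K, (τ u).card = 1 := by
      intro u hu
      have := (hKS u hu).1.card_pos
      have := hsize u (by have := Finset.card_le_card (hKS u hu).2; omega)
      omega
    have : K.card ≤ (S.powersetCard 1).card := by
      refine Finset.card_le_card_of_injOn (fun u => τ u) (fun u hu => ?_) fun u hu v hv he => ?_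
      · exact Finset.mem_coe.2 (Finset.mem_powersetCard.2 ⟨(hKS u hu).2, h1 u hu⟩)
      · by_contra huv
        obtain ⟨q, hq⟩ := Finset.card_eq_one.1 (h1 u hu)
        exact hst u v q hq (he.symm.trans hq) (hK hu hv huv)
    rwa [Finset.card_powersetCard, hS] at this
  obtain ⟨c, hc, hcp⟩ := h.exists_coloring_of_card_le (S := Q \ A) (D := A)
    (U := traceSide G Q (Q \ A)) (by omega) (fun u hu => hu.2)
    (fun K hK hKS => (hside _ hB K hK hKS).trans hA.ge)
  refine h.colorable_of_bipartition (A := A) (B := Q \ A) (E := ∅) Finset.disjoint_sdiff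
    (Finset.union_sdiff_of_subset hAQ) (by omega) (by simp) ?_ hR ?_
    ⟨c, fun u hu => ⟨Finset.mem_union_left _ (hc u hu),
      fun hh => (Finset.mem_sdiff.1 (hu.2 hh)).2 (hc u hu)⟩, hcp⟩
  · intro u hu hu0
    obtain ⟨q, hq⟩ := Finset.card_eq_one.1 (le_antisymm (hsize u hu) hu0.card_pos)
    by_cases hqA : q ∈ A
    · exact Or.inl (by simpa [hq] using hqA)
    · refine Or.inr (Or.inl ?_)
      have hqQ : q ∈ Q := mem_of_mem_traceOn (u := u) (hq.ge (Finset.mem_singleton_self q))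
      simpa [hq] using ⟨hqQ, hqA⟩
  · intro K hK hKA
    rw [Finset.sdiff_empty, hB]
    exact hside A hA K hK hKA

theorem colorable_of_anticomplete_pair
    (hsize : ∀ u, (τ u).card + 2 ≤ Q.card → (τ u).card ≤ 1)
    (hR : ∀ u v, τ u = ∅ → τ v = ∅ → ¬ G.Adj u v) {i j k l : V} (hQ : Q = {i, j, k, l})
    (hij : i ≠ j) (hik : i ≠ k) (hil : i ≠ l) (hjk : j ≠ k) (hjl : j ≠ l) (hkl : k ≠ l)
    {a : V} (hi : ∀ u v, τ u = {i} → τ v = {i} → G.Adj u v → (u = a ↔ v ≠ a))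
    (hst : ∀ u v q, q ≠ i → τ u = {q} → τ v = {q} → ¬ G.Adj u v)
    (hanti : ∀ u v, τ u = {j} → τ v = {k} → ¬ G.Adj u v) : G.Colorable (Q.card + 1) := by
  have hsing : ∀ {p q : V}, ({p} : Finset V) = {q} ↔ p = q := Finset.singleton_inj
  let c : V → V ⊕ Fin 1 := fun u => if τ u = {i} then .inl (if u = a then k else l) else
    if τ u = {l} then .inl j else if τ u = ∅ then .inr 0 else .inl i
  have hi' : ∀ {u}, τ u = {i} → c u = .inl (if u = a then k else l) := fun hu => if_pos hu
  have hl' : ∀ {u}, τ u = {l} → c u = .inl j := fun hu => by simp [c, hu, hsing, hil.symm]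
  have hj' : ∀ {u}, τ u = {j} → c u = .inl i := fun hu => by simp [c, hu, hsing, hij.symm, hjl]
  have hk' : ∀ {u}, τ u = {k} → c u = .inl i := fun hu => by simp [c, hu, hsing, hik.symm, hkl]
  have h0' : ∀ {u}, τ u = ∅ → c u = .inr 0 := fun hu => by
    simp [c, hu, (Finset.singleton_ne_empty _).symm]
  have hcases : ∀ u, (τ u).card + 2 ≤ Q.card →
      τ u = ∅ ∨ τ u = {i} ∨ τ u = {j} ∨ τ u = {k} ∨ τ u = {l} := by
    intro u hu
    rcases (τ u).eq_empty_or_nonempty with hu0 | hu0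
    · exact Or.inl hu0
    obtain ⟨q, hq⟩ := Finset.card_eq_one.1 (le_antisymm (hsize u hu) hu0.card_pos)
    have hqQ : q ∈ Q := mem_of_mem_traceOn (u := u) (hq.ge (Finset.mem_singleton_self q))
    rw [hQ] at hqQ
    simp only [Finset.mem_insert, Finset.mem_singleton] at hqQ
    rw [hq]
    simp only [hsing]
    exact Or.inr hqQ
  refine h.colorable_of_small_coloring c ?_ ?_ ?_
  · intro u hu x hx
    rcases hcases u hu with hu | hu | hu | hu | hu
    · simp [h0' hu] at hx
    · rw [hi' hu] at hx
      rw [← Sum.inl_injective hx, hu, hQ]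
      split <;> simp [hik.symm, hil.symm]
    · rw [hj' hu] at hx
      rw [← Sum.inl_injective hx, hu, hQ]
      simp [hij]
    · rw [hk' hu] at hx
      rw [← Sum.inl_injective hx, hu, hQ]
      simp [hik]
    · rw [hl' hu] at hx
      rw [← Sum.inl_injective hx, hu, hQ]
      simp [hjl]
  · have hii : ∀ u v, τ u = {i} → τ v = {i} → G.Adj u v → c u ≠ c v := by
      intro u v hu hv huv
      rw [hi' hu, hi' hv]
      have := hi u v hu hv huv
      by_cases hua : u = a
      · simp [hua, this.1 hua, hkl]
      · have hva : v = a := by tauto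
        simp [hua, hva, hkl.symm]
    have hne : ∀ u v q, τ u = {i} → q ≠ k → q ≠ l → c v = .inl q → c u ≠ c v := by
      intro u v q hu hqk hql hv
      rw [hi' hu, hv]
      split <;> simp [hqk.symm, hql.symm]
    intro u v hu hv huv
    rcases hcases u hu with hu | hu | hu | hu | hu <;>
      rcases hcases v hv with hv | hv | hv | hv | hv
    · exact (hR u v hu hv huv).elim
    · simp [h0' hu, hi' hv]
    · simp [h0' hu, hj' hv]
    · simp [h0' hu, hk' hv]
    · simp [h0' hu, hl' hv]
    · simp [hi' hu, h0' hv]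
    · exact hii u v hu hv huv
    · exact hne u v i hu hik hil (hj' hv)
    · exact hne u v i hu hik hil (hk' hv)
    · exact hne u v j hu hjk hjl (hl' hv)
    · simp [hj' hu, h0' hv]
    · exact (hne v u i hv hik hil (hj' hu)).symm
    · exact (hst u v j hij.symm hu hv huv).elim
    · exact (hanti u v hu hv huv).elim
    · simp [hj' hu, hl' hv, hij]
    · simp [hk' hu, h0' hv]
    · exact (hne v u i hv hik hil (hk' hu)).symm
    · exact (hanti v u hv hu huv.symm).elim
    · exact (hst u v k hik.symm hu hv huv).elim
    · simp [hk' hu, hl' hv, hij]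
    · simp [hl' hu, h0' hv]
    · exact (hne v u j hv hjk hjl (hl' hu)).symm
    · simp [hl' hu, hj' hv, hij.symm]
    · simp [hl' hu, hk' hv, hij.symm]
    · exact (hst u v l hil.symm hu hv huv).elim
  · intro u w hu _ _ x hx
    simp [h0' hu] at hx

theorem colorable_of_card_traceOn_le_one [Fintype V]
    (hedge : ∀ L : Finset V, G.IsClique (L : Set V) → L.card = Q.card → ∀ u v, G.Adj u v →
      ∃ q ∈ L, G.Adj u q ∨ G.Adj v q)
    (hsize : ∀ u, (τ u).card + 2 ≤ Q.card → (τ u).card ≤ 1) : G.Colorable (Q.card + 1) := by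
  have h4 := h.four_le
  have hR : ∀ u v, τ u = ∅ → τ v = ∅ → ¬ G.Adj u v := by
    intro u v hu hv huv
    obtain ⟨q, hq, hq' | hq'⟩ := hedge Q h.isClique rfl u v huv
    · exact Finset.eq_empty_iff_forall_notMem.1 hu q (mem_traceOn.2 ⟨hq, hq'⟩)
    · exact Finset.eq_empty_iff_forall_notMem.1 hv q (mem_traceOn.2 ⟨hq, hq'⟩)
  have hd : ∀ u v, (τ u).card + 2 ≤ Q.card → (τ v).card + 2 ≤ Q.card → G.Adj u v →
      (τ u).Nonempty → (τ v).Nonempty → τ u = τ v ∨ Disjoint (τ u) (τ v) := by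
    intro u v hu hv _ hu0 hv0
    obtain ⟨p, hp⟩ := Finset.card_eq_one.1 (le_antisymm (hsize u hu) hu0.card_pos)
    obtain ⟨q, hq⟩ := Finset.card_eq_one.1 (le_antisymm (hsize v hv) hv0.card_pos)
    rw [hp, hq, Finset.singleton_inj, Finset.disjoint_singleton]
    exact eq_or_ne p q
  by_cases h5 : 5 ≤ Q.card
  · refine h.colorable_of_transitive (fun u v w hu hv hw huv hvw huw => ?_) hd
    refine h.adj_trans_of_subset (S := τ u ∪ (τ v ∪ τ w)) ?_ Finset.subset_union_left
      (Finset.subset_union_left.trans Finset.subset_union_right)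
      (Finset.subset_union_right.trans Finset.subset_union_right) huv hvw huw
    have := Finset.card_union_le (τ u) (τ v ∪ τ w)
    have := Finset.card_union_le (τ v) (τ w)
    have := hsize u hu
    have := hsize v hv
    have := hsize w hw
    omega
  have hcard : Q.card = 4 := by omega
  by_cases hst : ∀ u v q, τ u = {q} → τ v = {q} → ¬ G.Adj u v
  · exact h.colorable_of_singleton_stable hcard hsize hR hst
  push Not at hst
  obtain ⟨a, b, i, ha, hb, hab⟩ := hst
  have hiQ : i ∈ Q := mem_of_mem_traceOn (u := a) (ha.ge (Finset.mem_singleton_self i))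
  by_cases hother : ∀ v q, τ v = {q} → q = i
  · have hsub : ∀ u, (τ u).card + 2 ≤ Q.card → τ u ⊆ {i, i} := by
      intro u hu
      rcases (τ u).eq_empty_or_nonempty with hu0 | hu0
      · simp [hu0]
      obtain ⟨p, hp⟩ := Finset.card_eq_one.1 (le_antisymm (hsize u hu) hu0.card_pos)
      simp [hp, hother u p hp]
    exact h.colorable_of_transitive (fun u v w hu hv hw => h.adj_trans_of_singleton (hsub u hu)
      (hsub v hv) (hsub w hw)) hd
  push Not at hother
  obtain ⟨v, q, hv, hqi⟩ := hother
  have hfour : ∀ p q u v w z, τ u ⊆ {p, q} → τ v ⊆ {p, q} → τ w ⊆ {p, q} → τ z ⊆ {p, q} →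
      G.Adj u v → G.Adj u w → G.Adj u z → G.Adj v w → G.Adj v z → G.Adj w z → False := by
    intro p q u v w z hu hv hw hz huv huw huz hvw hvz hwz
    have h1 := h.card_add_one_le_of_traceOn_subset hedge (S := {p, q}) (M := {u, v, w, z})
      (by have := Finset.card_le_two (a := p) (b := q); omega)
      (by simp [SimpleGraph.isClique_insert, *])
      (by simp [*])
    have h2 : ({u, v, w, z} : Finset V).card = 4 := by
      rw [Finset.card_insert_of_notMem, Finset.card_insert_of_notMem, Finset.card_pair hwz.ne] <;>
        simp [huv.ne, huw.ne, huz.ne, hvw.ne, hvz.ne]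
    omega
  have hone : ∀ u v q, q ≠ i → τ u = {q} → τ v = {q} → u = v := by
    intro u v q hq hu hv
    by_contra huv
    have hua := h.adj_of_edge hab ha hb hu hq
    have hva := h.adj_of_edge hab ha hb hv hq
    have hub := h.adj_of_edge hab.symm hb ha hu hq
    have hvb := h.adj_of_edge hab.symm hb ha hv hq
    have huv := h.adj_trans_of_singleton (i := i) (j := q) (by simp [hu]) (by simp [ha])
      (by simp [hv]) hua hva.symm huv
    exact hfour i q a b u v (by simp [ha]) (by simp [hb]) (by simp [hu]) (by simp [hv]) hab
      hua.symm hva.symm hub.symm hvb.symm huv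
  have hst : ∀ u v q, q ≠ i → τ u = {q} → τ v = {q} → ¬ G.Adj u v := fun u v q hq hu hv huv =>
    huv.ne (hone u v q hq hu hv)
  have hi : ∀ u, τ u = {i} → G.Adj v u → u ≠ a → u = b := by
    intro u hu hvu hua
    by_contra hub
    have hva := h.adj_of_edge hab ha hb hv hqi
    have hvb := h.adj_of_edge hab.symm hb ha hv hqi
    have h1 := h.adj_trans_of_singleton (i := i) (j := q) (by simp [hu]) (by simp [hv])
      (by simp [ha]) hvu.symm hva hua
    have h2 := h.adj_trans_of_singleton (i := i) (j := q) (by simp [hu]) (by simp [hv])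
      (by simp [hb]) hvu.symm hvb hub
    exact hfour i q a b u v (by simp [ha]) (by simp [hb]) (by simp [hu]) (by simp [hv]) hab
      h1.symm hva.symm h2.symm hvb.symm hvu.symm
  have hi' : ∀ u v, τ u = {i} → τ v = {i} → G.Adj u v → (u = a ↔ v ≠ a) := by
    intro u w hu hw huw
    have h1 := hi u hu (h.adj_of_edge huw hu hw hv hqi)
    have h2 := hi w hw (h.adj_of_edge huw.symm hw hu hv hqi)
    have := huw.ne
    constructor
    · rintro rfl
      exact this.symm
    · intro hwa
      by_contra hua
      exact this ((h1 hua).trans (h2 hwa).symm)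
  have hQ' : (Q.erase i).card = 3 := by rw [Finset.card_erase_of_mem hiQ, hcard]
  obtain ⟨j, k, l, hjk, hjl, hkl, hjkl⟩ := Finset.card_eq_three.1 hQ'
  have hQ : Q = {i, j, k, l} := by rw [← Finset.insert_erase hiQ, hjkl]
  have hnot : i ∉ ({j, k, l} : Finset V) := hjkl ▸ Finset.notMem_erase i Q
  simp only [Finset.mem_insert, Finset.mem_singleton, not_or, ← ne_eq] at hnot
  obtain ⟨hij, hik, hil⟩ := hnot
  by_cases h1 : ∀ u v, τ u = {j} → τ v = {k} → ¬ G.Adj u v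
  · exact h.colorable_of_anticomplete_pair hsize hR hQ hij hik hil hjk hjl hkl hi' hst h1
  by_cases h2 : ∀ u v, τ u = {j} → τ v = {l} → ¬ G.Adj u v
  · exact h.colorable_of_anticomplete_pair hsize hR
      (by rw [hQ, Finset.pair_comm k l] : Q = {i, j, l, k})
      hij hil hik hjl hjk hkl.symm hi' hst h2
  by_cases h3 : ∀ u v, τ u = {k} → τ v = {l} → ¬ G.Adj u v
  · exact h.colorable_of_anticomplete_pair hsize hR
      (by rw [hQ]; ext; simp; tauto : Q = {i, k, l, j})
      hik hil hij hkl hjk.symm hjl.symm hi' hst h3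
  push Not at h1 h2 h3
  obtain ⟨x, y, hx, hy, hxy⟩ := h1
  obtain ⟨x', z, hx', hz, hxz⟩ := h2
  obtain ⟨y', z', hy', hz', hyz⟩ := h3
  obtain rfl := hone x x' j hij.symm hx hx'
  obtain rfl := hone y y' k hik.symm hy hy'
  obtain rfl := hone z z' l hil.symm hz hz'
  have hA : ∀ {u q}, τ u = {q} → q ≠ i → G.Adj a u ∧ G.Adj b u := fun hu hq =>
    ⟨(h.adj_of_edge hab ha hb hu hq).symm, (h.adj_of_edge hab.symm hb ha hu hq).symm⟩
  have hax := hA hx hij.symm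
  have hay := hA hy hik.symm
  have haz := hA hz hil.symm
  have hle := h.card_le {a, b, x, y, z} (by simp [SimpleGraph.isClique_insert, *])
  have heq : ({a, b, x, y, z} : Finset V).card = 5 := by
    rw [Finset.card_insert_of_notMem, Finset.card_insert_of_notMem,
      Finset.card_insert_of_notMem, Finset.card_pair hyz.ne] <;>
      simp [hab.ne, hax.1.ne, hax.2.ne, hay.1.ne, hay.2.ne, haz.1.ne, haz.2.ne, hxy.ne, hxz.ne]
  omega

end CliqueSetting

namespace CliqueSetting

variable (h : CliqueSetting G Q)
include h

theorem colorable [Fintype V] {k : ℕ} (hk : 1 ≤ k) (hQk : Q.card ≤ 4 * k + 1) :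
    G.Colorable (Q.card + k) := by
  by_cases hedge : ∀ L : Finset V, G.IsClique (L : Set V) → L.card = Q.card → ∀ u v, G.Adj u v →
      ∃ q ∈ L, G.Adj u q ∨ G.Adj v q
  · refine SimpleGraph.Colorable.mono (by omega : Q.card + 1 ≤ Q.card + k) ?_
    by_cases hsize : ∀ u, (τ u).card + 2 ≤ Q.card → (τ u).card ≤ 1
    · exact h.colorable_of_card_traceOn_le_one hedge hsize
    push Not at hsize
    obtain ⟨u, hu, hu1⟩ := hsize
    obtain ⟨x, hx, hmax⟩ := Finset.exists_max_image
      (Finset.univ.filter fun v => (τ v).card + 2 ≤ Q.card) (fun v => (τ v).card)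
      ⟨u, by simpa using hu⟩
    simp only [Finset.mem_filter, Finset.mem_univ, true_and] at hx hmax
    refine TraceSplit.colorable (Q := Q) (A := τ x) (B := Q \ τ x)
      { h with
        disj := Finset.disjoint_sdiff
        union_eq := Finset.union_sdiff_of_subset (traceOn_subset x)
        two_le_left := hu1.trans_le (hmax u hu)
        two_le_right := ?_
        exists_eq := ⟨x, rfl⟩
        card_traceOn_le := hmax
        exists_adj := hedge }
    rw [Finset.card_sdiff_of_subset (traceOn_subset x)]
    omega
  push Not at hedge
  obtain ⟨L, hL, hLQ, r, r', hrr, hr⟩ := hedge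
  have h' : CliqueSetting G L := ⟨h.p2p3_free, h.gem_free, hL, fun K hK => hLQ ▸ h.card_le K hK,
    hLQ ▸ h.four_le⟩
  have he : ∀ s, (∀ q ∈ L, ¬ G.Adj s q) → traceOn G L s = ∅ := fun s hs =>
    Finset.filter_eq_empty_iff.2 fun q hq => hs q hq
  have := h'.colorable_of_edge_empty (k := k) (he r fun q hq => (hr q hq).1)
    (he r' fun q hq => (hr q hq).2) hrr (by omega)
  rwa [hLQ] at this

end CliqueSetting

end CliqueTraces

/-- Every (P2+P3, gem)-free graph `G` with `ω(G) ≥ 4` satisfies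
`χ(G) ≤ ⌈(5ω(G) − 1)/4⌉`. -/
theorem chi_le_ceil_of_p2p3_gem_free {V : Type*} [Fintype V] (G : SimpleGraph V)
    (h1 : IsFreeOf G graphP2P3) (h2 : IsFreeOf G graphGem)
    (hw : 4 ≤ G.cliqueNum) :
    G.chromaticNumber ≤ ((⌈(5 * (G.cliqueNum : ℚ) - 1) / 4⌉₊ : ℕ) : ℕ∞) := by
  obtain ⟨Q, hQ⟩ := G.exists_isNClique_cliqueNum
  have h : CliqueSetting G Q := ⟨h1, h2, hQ.isClique,
    fun K hK => hQ.card_eq ▸ hK.card_le_cliqueNum, hQ.card_eq ▸ hw⟩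
  rw [← hQ.card_eq] at hw ⊢
  refine SimpleGraph.chromaticNumber_le_iff_colorable.2
    ((h.colorable (k := (Q.card + 2) / 4) (by omega) (by omega)).mono ?_)
  have hceil := Nat.le_ceil ((5 * (Q.card : ℚ) - 1) / 4)
  rw [div_le_iff₀ (by norm_num), sub_le_iff_le_add] at hceil
  have : 5 * Q.card ≤ ⌈(5 * (Q.card : ℚ) - 1) / 4⌉₊ * 4 + 1 := by exact_mod_cast hceil
  omega
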